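/- Suppose 4 ≤ n < m − 1 and A = i_1 i_2 ⋯ i_n ⊆ [m] with i_1 ≥ 2 (entries increasing). Let K = VR(F^m_{n−2} ∪ F^m_n, 2) ∩ VR(F^m_{⪯A}, 2). Then the link of A in K is homotopy equivalent to a wedge sum of s_A copies of the 2-sphere S², where s_A = Σ_{k=2}^{n−2} (k choose 2) + Σ_{ℓ=1}^{n−2} c_ℓ·(n−ℓ choose 2) with c_1 = i_1 − 1 and c_ℓ = i_ℓ − (i_{ℓ−1} + 1) for ℓ = 2, …, n. -/

import Mathlib

open Finset

/-- An abstract simplicial complex on a vertex type `V`: a collection of nonempty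
finite subsets of `V` (the faces), closed under taking nonempty subsets. -/
structure AbsSC (V : Type) where
  faces : Set (Finset V)
  not_empty_mem : ∅ ∉ faces
  down_closed : ∀ s ∈ faces, ∀ t : Finset V, t ⊆ s → t ≠ ∅ → t ∈ faces

namespace AbsSC

variable {V W : Type}

/-- The vertex set of a simplicial complex. -/
def vertices (K : AbsSC V) : Set V := {v | ({v} : Finset V) ∈ K.faces}

/-- The geometric realization of a simplicial complex: the space of convex weightings
supported on a face, topologized as a subspace of `V → ℝ`. -/
def space (K : AbsSC V) : Type :=
  {f : V → ℝ // (∀ v, 0 ≤ f v) ∧ ∃ s ∈ K.faces, (∀ v, f v ≠ 0 → v ∈ s) ∧ ∑ v ∈ s, f v = 1}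

instance (K : AbsSC V) : TopologicalSpace K.space := by unfold space; infer_instance

/-- `L` is a subcomplex of `K`. -/
def IsSubcomplex (L K : AbsSC V) : Prop := L.faces ⊆ K.faces

/-- Homotopy equivalence of simplicial complexes (of their geometric realizations). -/
def HEquiv (K : AbsSC V) (L : AbsSC W) : Prop :=
  Nonempty (ContinuousMap.HomotopyEquiv K.space L.space)

/-- The realization of `K` is homotopy equivalent to the topological space `X`. -/
def HEquivTop (K : AbsSC V) (X : Type) [TopologicalSpace X] : Prop :=
  Nonempty (ContinuousMap.HomotopyEquiv K.space X)

/-- The inclusion of realizations induced by a subcomplex inclusion. -/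
def incl {L K : AbsSC V} (h : L.faces ⊆ K.faces) : C(L.space, K.space) where
  toFun f := ⟨f.1, f.2.1, by obtain ⟨s, hs, h1, h2⟩ := f.2.2; exact ⟨s, h hs, h1, h2⟩⟩
  continuous_toFun := Continuous.subtype_mk continuous_subtype_val _

variable [DecidableEq V]

/-- The link of a vertex. -/
def link (K : AbsSC V) (v : V) : AbsSC V where
  faces := {σ | σ ≠ ∅ ∧ v ∉ σ ∧ σ ∪ {v} ∈ K.faces}
  not_empty_mem h := h.1 rfl
  down_closed := by
    rintro s ⟨hne, hv, hs⟩ t hts htne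
    exact ⟨htne, fun hvt => hv (hts hvt),
      K.down_closed _ hs _ (Finset.union_subset_union hts (Finset.Subset.refl _)) (by simp [Finset.union_eq_empty])⟩

lemma link_subset (K : AbsSC V) (v : V) : (K.link v).faces ⊆ K.faces := by
  rintro σ ⟨hne, hv, hσ⟩
  exact K.down_closed _ hσ _ Finset.subset_union_left hne

/-- The complex induced on the vertices other than `v`. -/
def delete (K : AbsSC V) (v : V) : AbsSC V where
  faces := {σ | σ ∈ K.faces ∧ v ∉ σ}
  not_empty_mem h := K.not_empty_mem h.1
  down_closed := by
    rintro s ⟨hs, hv⟩ t hts htne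
    exact ⟨K.down_closed _ hs _ hts htne, fun h => hv (hts h)⟩

/-- The star of a vertex: `st_K(v) = {σ : σ ∪ {v} ∈ K}`. -/
def star (K : AbsSC V) (v : V) : AbsSC V where
  faces := {σ | σ ≠ ∅ ∧ σ ∪ {v} ∈ K.faces}
  not_empty_mem h := h.1 rfl
  down_closed := by
    rintro s ⟨hne, hs⟩ t hts htne
    exact ⟨htne,
      K.down_closed _ hs _ (Finset.union_subset_union hts (Finset.Subset.refl _)) (by simp [Finset.union_eq_empty])⟩

/-- The star cluster of a subcomplex `L` in `K`: the union of stars of vertices of `L`. -/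
def starCluster (K L : AbsSC V) : AbsSC V where
  faces := {σ | σ ≠ ∅ ∧ ∃ v, ({v} : Finset V) ∈ L.faces ∧ σ ∪ {v} ∈ K.faces}
  not_empty_mem h := h.1 rfl
  down_closed := by
    rintro s ⟨hne, v, hvL, hs⟩ t hts htne
    exact ⟨htne, v, hvL,
      K.down_closed _ hs _ (Finset.union_subset_union hts (Finset.Subset.refl _)) (by simp [Finset.union_eq_empty])⟩

/-- The union of two simplicial complexes. -/
def union (K₁ K₂ : AbsSC V) : AbsSC V where
  faces := K₁.faces ∪ K₂.faces
  not_empty_mem h := by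
    rcases h with h | h
    exacts [K₁.not_empty_mem h, K₂.not_empty_mem h]
  down_closed := by
    rintro s (hs | hs) t hts htne
    exacts [Or.inl (K₁.down_closed _ hs _ hts htne), Or.inr (K₂.down_closed _ hs _ hts htne)]

/-- The union of a family of simplicial complexes. -/
def iUnionC {ι : Type} (F : ι → AbsSC V) : AbsSC V where
  faces := ⋃ i, (F i).faces
  not_empty_mem h := by
    obtain ⟨i, hi⟩ := Set.mem_iUnion.mp h
    exact (F i).not_empty_mem hi
  down_closed := by
    intro s hs t hts htne
    obtain ⟨i, hi⟩ := Set.mem_iUnion.mp hs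
    exact Set.mem_iUnion.mpr ⟨i, (F i).down_closed _ hi _ hts htne⟩

/-- The `n`-skeleton of a complex: all faces with at most `n+1` vertices. -/
def skeleton (K : AbsSC V) (n : ℕ) : AbsSC V where
  faces := {σ | σ ∈ K.faces ∧ σ.card ≤ n + 1}
  not_empty_mem h := K.not_empty_mem h.1
  down_closed := by
    rintro s ⟨hs, hcard⟩ t hts htne
    exact ⟨K.down_closed _ hs _ hts htne, le_trans (Finset.card_le_card hts) hcard⟩

/-- The simplicial complex generated by a single simplex `s` (all its nonempty subsets). -/
def simplexCx (s : Finset V) : AbsSC V where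
  faces := {t | t ≠ ∅ ∧ t ⊆ s}
  not_empty_mem h := h.1 rfl
  down_closed := by
    rintro a ⟨hne, has⟩ t hta htne
    exact ⟨htne, hta.trans has⟩

/-- A maximal simplex (facet) of `K`. -/
def IsFacet (K : AbsSC V) (σ : Finset V) : Prop :=
  σ ∈ K.faces ∧ ∀ τ ∈ K.faces, σ ⊆ τ → τ = σ

/-- `K` is a clique complex: any nonempty set of vertices which pairwise span edges is a face. -/
def IsCliqueCx (K : AbsSC V) : Prop :=
  ∀ σ : Finset V, σ ≠ ∅ → (∀ v ∈ σ, ({v} : Finset V) ∈ K.faces) →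
    (∀ v ∈ σ, ∀ w ∈ σ, v ≠ w → ({v, w} : Finset V) ∈ K.faces) → σ ∈ K.faces

/-- `L` is a full subcomplex of `K`. -/
def IsFull (L K : AbsSC V) : Prop :=
  ∀ σ ∈ K.faces, (∀ v ∈ σ, ({v} : Finset V) ∈ L.faces) → σ ∈ L.faces

end AbsSC

noncomputable section

/-- The `n`-dimensional sphere. -/
abbrev Sph (n : ℕ) : Type := Metric.sphere (0 : EuclideanSpace ℝ (Fin (n + 1))) 1

/-- A base point on the sphere. -/
def sphBase (n : ℕ) : Sph n :=
  ⟨EuclideanSpace.single 0 1, by simp⟩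

/-- Relation gluing the base points of `c` copies of a pointed space to an auxiliary point. -/
inductive wedgeRel (c : ℕ) (X : Type) (x₀ : X) : Unit ⊕ Fin c × X → Unit ⊕ Fin c × X → Prop
  | glue (i : Fin c) : wedgeRel c X x₀ (Sum.inl ()) (Sum.inr (i, x₀))

/-- The wedge sum of `c` copies of the pointed space `(X, x₀)`. -/
def Wedge (c : ℕ) (X : Type) [TopologicalSpace X] (x₀ : X) : Type := Quot (wedgeRel c X x₀)

instance (c : ℕ) (X : Type) [TopologicalSpace X] (x₀ : X) : TopologicalSpace (Wedge c X x₀) := by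
  unfold Wedge; infer_instance

/-- The base point of the wedge. -/
def wedgePt (c : ℕ) (X : Type) [TopologicalSpace X] (x₀ : X) : Wedge c X x₀ :=
  Quot.mk _ (Sum.inl ())

/-- The wedge sum of `c` copies of the `n`-sphere. -/
abbrev WedgeSph (n c : ℕ) : Type := Wedge c (Sph n) (sphBase n)

/-- The base point of a wedge of spheres. -/
def wedgeSphPt (n c : ℕ) : WedgeSph n c := wedgePt c _ _

/-- Relation gluing the two base points in a binary wedge. -/
inductive wedge2Rel (X Y : Type) (x₀ : X) (y₀ : Y) : X ⊕ Y → X ⊕ Y → Prop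
  | glue : wedge2Rel X Y x₀ y₀ (Sum.inl x₀) (Sum.inr y₀)

/-- The wedge sum `X ∨ Y` of two pointed spaces. -/
def Wedge2 (X Y : Type) [TopologicalSpace X] [TopologicalSpace Y] (x₀ : X) (y₀ : Y) : Type :=
  Quot (wedge2Rel X Y x₀ y₀)

instance (X Y : Type) [TopologicalSpace X] [TopologicalSpace Y] (x₀ : X) (y₀ : Y) :
    TopologicalSpace (Wedge2 X Y x₀ y₀) := by unfold Wedge2; infer_instance

/-- Relation collapsing the top and bottom of the cylinder `X × [0,1]` to two cone points. -/
inductive suspRel (X : Type) : X × unitInterval ⊕ Bool → X × unitInterval ⊕ Bool → Prop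
  | zero (x : X) : suspRel X (Sum.inl (x, 0)) (Sum.inr false)
  | one (x : X) : suspRel X (Sum.inl (x, 1)) (Sum.inr true)

/-- The (unreduced) suspension `Σ X`. -/
def Susp (X : Type) [TopologicalSpace X] : Type := Quot (suspRel X)

instance (X : Type) [TopologicalSpace X] : TopologicalSpace (Susp X) := by
  unfold Susp; infer_instance

/-- The north cone point of the suspension. -/
def suspNorth (X : Type) [TopologicalSpace X] : Susp X := Quot.mk _ (Sum.inr true)

end

/-- The Vietoris–Rips complex at scale `r` of a collection `F` of finite subsets of `ℕ`,
with respect to the symmetric difference metric `d(A,B) = |A Δ B|`. -/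
def VRc (F : Set (Finset ℕ)) (r : ℕ) : AbsSC (Finset ℕ) where
  faces := {σ | σ.Nonempty ∧ (∀ A ∈ σ, A ∈ F) ∧
    ∀ A ∈ σ, ∀ B ∈ σ, (symmDiff A B).card ≤ r}
  not_empty_mem h := by simpa using h.1
  down_closed := by
    rintro s ⟨hne, hF, hd⟩ t hts htne
    exact ⟨Finset.nonempty_iff_ne_empty.mpr htne, fun A hA => hF A (hts hA),
      fun A hA B hB => hd A (hts hA) B (hts hB)⟩

/-- `F_n^m`: all `n`-element subsets of `[m] = {1, …, m}`. -/
def Fnm (m n : ℕ) : Set (Finset ℕ) := {A | A ⊆ Finset.Icc 1 m ∧ A.card = n}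

/-- `F_{≤ n}^m`: all subsets of `[m]` of cardinality at most `n`. -/
def Fle (m n : ℕ) : Set (Finset ℕ) := {A | A ⊆ Finset.Icc 1 m ∧ A.card ≤ n}

/-- The simplex `N[C] = {A : C ⊆ A, |A \ C| = 1}` inside `[m]`. -/
def NSimp (m : ℕ) (C : Finset ℕ) : Finset (Finset ℕ) :=
  (Finset.Icc 1 m \ C).image (fun x => insert x C)

/-- The simplex `L[S]`: all subsets of `S` obtained by removing one element. -/
def LSimp (S : Finset ℕ) : Finset (Finset ℕ) := S.image (fun x => S.erase x)

/-- The total order `≺`: first compare cardinalities, then compare the increasing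
enumerations lexicographically. -/
def precLT (A B : Finset ℕ) : Prop :=
  A.card < B.card ∨
    (A.card = B.card ∧ List.Lex (· < ·) (A.sort (· ≤ ·)) (B.sort (· ≤ ·)))

/-- `A ⪯ B`. -/
def precLE (A B : Finset ℕ) : Prop := precLT A B ∨ A = B

/-- `F^m_{≺ A}`: all subsets of `[m]` strictly preceding `A`. -/
def FprecLT (m : ℕ) (A : Finset ℕ) : Set (Finset ℕ) :=
  {B | B ⊆ Finset.Icc 1 m ∧ precLT B A}

/-- `F^m_{⪯ A}`: all subsets of `[m]` preceding (or equal to) `A`. -/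
def FprecLE (m : ℕ) (A : Finset ℕ) : Set (Finset ℕ) :=
  {B | B ⊆ Finset.Icc 1 m ∧ precLE B A}

/-- The `j`-th value (0-indexed) of an enumeration `i : Fin n → ℕ`. -/
def ith {n : ℕ} (i : Fin n → ℕ) (j : ℕ) : ℕ := if h : j < n then i ⟨j, h⟩ else 0

/-- The `ℓ`-th entry (1-indexed) of the enumeration, as an integer, with `i_0 = -1`. -/
def ivZ {n : ℕ} (i : Fin n → ℕ) (ℓ : ℕ) : ℤ := if ℓ = 0 then -1 else (ith i (ℓ - 1) : ℤ)

/-- For `B = i_1 i_2 ⋯ i_n` (increasing), with `d_1 = i_1` and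
`d_ℓ = i_ℓ - (i_{ℓ-1} + 1)`, `r_B = Σ_{k=2}^{n-2} C(k,2) + Σ_{ℓ=1}^{n-2} d_ℓ·C(n-ℓ,2)`. -/
def rA (B : Finset ℕ) : ℕ :=
  (∑ k ∈ Finset.Icc 2 (B.card - 2), Nat.choose k 2) +
    ∑ ℓ ∈ Finset.Icc 1 (B.card - 2),
      ((B.sort (· ≤ ·)).getD (ℓ - 1) 0 -
        (if ℓ = 1 then 0 else (B.sort (· ≤ ·)).getD (ℓ - 2) 0 + 1)) * Nat.choose (B.card - ℓ) 2

/-- For `B = i_1 i_2 ⋯ i_n` (increasing), with `c_1 = i_1 - 1` and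
`c_ℓ = i_ℓ - (i_{ℓ-1} + 1)`, `s_B = Σ_{k=2}^{n-2} C(k,2) + Σ_{ℓ=1}^{n-2} c_ℓ·C(n-ℓ,2)`. -/
def sA (B : Finset ℕ) : ℕ :=
  (∑ k ∈ Finset.Icc 2 (B.card - 2), Nat.choose k 2) +
    ∑ ℓ ∈ Finset.Icc 1 (B.card - 2),
      ((B.sort (· ≤ ·)).getD (ℓ - 1) 0 -
        (if ℓ = 1 then 1 else (B.sort (· ≤ ·)).getD (ℓ - 2) 0 + 1)) * Nat.choose (B.card - ℓ) 2

/-- `t_n = Σ_{A ⊆ [m], |A| = n} r_A`. -/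
def tN (m n : ℕ) : ℕ :=
  ∑ A ∈ (Finset.Icc 1 m).powerset.filter (fun A => A.card = n), rA A

/-- `o_{m,n} = Σ { s_A : A ∈ F^m_{n+2}, min A ≥ 2 }`. -/
def omn (m n : ℕ) : ℕ :=
  ∑ A ∈ (Finset.Icc 1 m).powerset.filter (fun A => A.card = n + 2 ∧ ∀ x ∈ A, 2 ≤ x), sA A

open Topology unitInterval in
/-- Collapsing a subspace `C` that can be deformed to a point through a homotopy of the whole
space preserving `C` is a homotopy equivalence. -/
theorem homotopyEquiv_of_isQuotientMap {X W : Type} [TopologicalSpace X] [TopologicalSpace W]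
    {p : X → W} (hp : IsQuotientMap p) {C : Set X}
    (hpC : ∀ x y, p x = p y → x = y ∨ (x ∈ C ∧ y ∈ C)) (hC : ∀ x ∈ C, ∀ y ∈ C, p x = p y)
    (H : C(I × X, X)) (H0 : ∀ x, H (0, x) = x) (HC : ∀ t, ∀ x ∈ C, H (t, x) ∈ C)
    (H1 : ∀ x ∈ C, ∀ y ∈ C, H (1, x) = H (1, y)) :
    Nonempty (ContinuousMap.HomotopyEquiv X W) := by
  let pc : C(X, W) := ⟨p, hp.continuous⟩
  have hpc : IsQuotientMap pc := hp
  have hcompat : ∀ t x y, p x = p y → p (H (t, x)) = p (H (t, y)) := by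
    intro t x y hxy
    rcases hpC x y hxy with rfl | ⟨hx, hy⟩
    · rfl
    · exact hC _ (HC t x hx) _ (HC t y hy)
  let H1c : C(X, X) := H.comp ⟨fun x => (1, x), by fun_prop⟩
  have hfac : Function.FactorsThrough H1c pc := by
    intro x y hxy
    rcases hpC x y hxy with rfl | ⟨hx, hy⟩
    · rfl
    · exact H1 x hx y hy
  let q : C(W, X) := hpc.lift H1c hfac
  have hq : ∀ x, q (p x) = H (1, x) := fun x =>
    DFunLike.congr_fun (hpc.lift_comp H1c hfac) x
  let s : W → X := Function.surjInv hp.surjective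
  have hs : ∀ w, p (s w) = w := Function.surjInv_eq hp.surjective
  let G : I × W → W := fun z => p (H (z.1, s z.2))
  have hG : ∀ t x, G (t, p x) = p (H (t, x)) := fun t x => hcompat t _ _ (hs _)
  have hGc : Continuous G := by
    refine hp.continuous_lift_prod_right ?_
    simp only [hG]
    exact hp.continuous.comp (H.continuous.comp (by fun_prop))
  refine ⟨⟨pc, q, ?_, ?_⟩⟩
  · refine ContinuousMap.Homotopic.symm ⟨⟨H, H0, fun x => ?_⟩⟩
    exact (hq x).symm
  · refine ContinuousMap.Homotopic.symm ⟨⟨⟨G, hGc⟩, fun w => ?_, fun w => ?_⟩⟩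
    · obtain ⟨x, rfl⟩ := hp.surjective w
      change G (0, p x) = p x
      rw [hG, H0]
    · obtain ⟨x, rfl⟩ := hp.surjective w
      change G (1, p x) = p (q (p x))
      rw [hG, hq]

namespace AbsSC

variable {V W X : Type} [TopologicalSpace X]

theorem space_nonneg {K : AbsSC V} (x : K.space) (v : V) : 0 ≤ x.1 v := x.2.1 v

theorem space_continuous_apply {K : AbsSC V} (v : V) : Continuous fun x : K.space => x.1 v :=
  (continuous_apply v).comp continuous_subtype_val

theorem space_sum_eq_one {K : AbsSC V} (x : K.space) {σ : Finset V}
    (h : ∀ v, x.1 v ≠ 0 → v ∈ σ) : ∑ v ∈ σ, x.1 v = 1 := by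
  classical
  obtain ⟨s, -, hs, h1⟩ := x.2.2
  refine Eq.trans (b := ∑ v ∈ σ ∪ s, x.1 v) ?_ (Eq.trans ?_ h1)
  · exact sum_subset subset_union_left fun v _ hv => by_contra fun h' => hv (h v h')
  · exact (sum_subset subset_union_right fun v _ hv => by_contra fun h' => hv (hs v h')).symm

theorem space_exists_ne_zero {K : AbsSC V} (x : K.space) : ∃ v, x.1 v ≠ 0 := by
  obtain ⟨s, -, -, h1⟩ := x.2.2
  by_contra! h
  simp [h] at h1

/-- The support of a point of the realization is a face. -/
theorem space_exists_support {K : AbsSC V} (x : K.space) :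
    ∃ σ ∈ K.faces, ∀ v, v ∈ σ ↔ x.1 v ≠ 0 := by
  classical
  obtain ⟨s, hs, h, -⟩ := x.2.2
  have hmem : ∀ v, v ∈ s.filter (fun v => x.1 v ≠ 0) ↔ x.1 v ≠ 0 := fun v => by
    simpa using h v
  obtain ⟨v, hv⟩ := space_exists_ne_zero x
  exact ⟨_, K.down_closed s hs _ (filter_subset _ _) (ne_empty_of_mem ((hmem v).2 hv)), hmem⟩

/-- Two maps into a realization that send each point into a common face are homotopic. -/
theorem homotopic_of_common_face {K : AbsSC V} (φ ψ : C(X, K.space))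
    (h : ∀ x, ∃ σ ∈ K.faces, (∀ v, (φ x).1 v ≠ 0 → v ∈ σ) ∧ ∀ v, (ψ x).1 v ≠ 0 → v ∈ σ) :
    φ.Homotopic ψ := by
  have hφ : Continuous fun z : unitInterval × X => (φ z.2).1 :=
    continuous_subtype_val.comp (φ.continuous.comp continuous_snd)
  have hψ : Continuous fun z : unitInterval × X => (ψ z.2).1 :=
    continuous_subtype_val.comp (ψ.continuous.comp continuous_snd)
  refine ⟨⟨⟨fun z => ⟨(1 - (z.1 : ℝ)) • (φ z.2).1 + (z.1 : ℝ) • (ψ z.2).1, ?_, ?_⟩, ?_⟩, ?_, ?_⟩⟩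
  · intro v
    have := z.1.2.1
    have := z.1.2.2
    have := space_nonneg (φ z.2) v
    have := space_nonneg (ψ z.2) v
    simp only [Pi.add_apply, Pi.smul_apply, smul_eq_mul]
    have := sub_nonneg.2 z.1.2.2
    positivity
  · obtain ⟨σ, hσ, h1, h2⟩ := h z.2
    refine ⟨σ, hσ, fun v hv => ?_, ?_⟩
    · by_contra hvσ
      have e1 : (φ z.2).1 v = 0 := by_contra fun h' => hvσ (h1 v h')
      have e2 : (ψ z.2).1 v = 0 := by_contra fun h' => hvσ (h2 v h')
      simp [e1, e2] at hv
    · simp only [Pi.add_apply, Pi.smul_apply, smul_eq_mul, sum_add_distrib, ← mul_sum,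
        space_sum_eq_one _ h1, space_sum_eq_one _ h2]
      ring
  · refine Continuous.subtype_mk ?_ _
    exact ((continuous_const.sub (continuous_subtype_val.comp continuous_fst)).smul hφ).add
      ((continuous_subtype_val.comp continuous_fst).smul hψ)
  · intro x
    refine Subtype.ext ?_
    simp
  · intro x
    refine Subtype.ext ?_
    simp

/-- A continuous family of nonzero nonnegative weightings, each supported on a face of `K`
contained in the finite set `E`, rescaled to a map into the realization. -/
noncomputable def normalize (K : AbsSC V) (E : Finset V) (g : X → V → ℝ) (hg : Continuous g)
    (h0 : ∀ x v, 0 ≤ g x v) (hne : ∀ x, ∃ v, g x v ≠ 0)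
    (hf : ∀ x, ∃ σ ∈ K.faces, σ ⊆ E ∧ ∀ v, g x v ≠ 0 → v ∈ σ) : C(X, K.space) :=
  have hpos : ∀ x, 0 < ∑ e ∈ E, g x e := fun x => by
    obtain ⟨v, hv⟩ := hne x
    obtain ⟨σ, -, hE, hσ⟩ := hf x
    exact sum_pos' (fun e _ => h0 x e) ⟨v, hE (hσ v hv), (h0 x v).lt_of_ne' hv⟩
  { toFun x := ⟨fun v => g x v / ∑ e ∈ E, g x e, fun v => div_nonneg (h0 x v) (hpos x).le, by
      obtain ⟨σ, hσ, hE, hs⟩ := hf x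
      refine ⟨σ, hσ, fun v hv => hs v (div_ne_zero_iff.1 hv).1, ?_⟩
      rw [← sum_div, div_eq_one_iff_eq (hpos x).ne']
      exact sum_subset hE fun v _ hv => by_contra fun h' => hv (hs v h')⟩
    continuous_toFun := by
      refine Continuous.subtype_mk (continuous_pi fun v => ?_) _
      have := fun v => (continuous_apply v).comp hg
      exact (this v).div (continuous_finsetSum _ fun e _ => this e) fun x => (hpos x).ne' }

/-- Relabelling the vertices along a bijection does not change the realization. -/
theorem homeomorph_of_equiv {K : AbsSC V} {L : AbsSC W} (e : V ≃ W)
    (h : ∀ σ, σ ∈ K.faces ↔ σ.map e.toEmbedding ∈ L.faces) : Nonempty (K.space ≃ₜ L.space) := by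
  refine ⟨⟨⟨fun x => ⟨fun w => x.1 (e.symm w), fun w => x.2.1 _, ?_⟩,
    fun x => ⟨fun v => x.1 (e v), fun v => x.2.1 _, ?_⟩, fun x => Subtype.ext ?_,
    fun x => Subtype.ext ?_⟩, ?_, ?_⟩⟩
  · obtain ⟨s, hs, h1, h2⟩ := x.2.2
    refine ⟨_, (h s).1 hs, fun w hw => ?_, ?_⟩
    · simpa [mem_map_equiv] using h1 _ hw
    · simpa using h2
  · obtain ⟨s, hs, h1, h2⟩ := x.2.2
    refine ⟨s.map e.symm.toEmbedding, (h _).2 ?_, fun v hv => ?_, ?_⟩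
    · simpa [Finset.map_map] using hs
    · simpa [mem_map_equiv] using h1 _ hv
    · simpa using h2
  · simp
  · simp
  · exact Continuous.subtype_mk (continuous_pi fun w => space_continuous_apply _) _
  · exact Continuous.subtype_mk (continuous_pi fun w => space_continuous_apply _) _

end AbsSC

section SphereCollapse

/-- The denominator in the formula for `triColl`. -/
def triDen (a b c : ℝ) : ℝ :=
  (a - c) ^ 2 + (b - c) ^ 2 + (1 - a - b - c) ^ 2 + min (min a b) c ^ 2

theorem triDen_pos (a b c : ℝ) : 0 < triDen a b c := by
  unfold triDen
  by_contra! h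
  have h1 := sq_nonneg (a - c)
  have h2 := sq_nonneg (b - c)
  have h3 := sq_nonneg (1 - a - b - c)
  have h4 := sq_nonneg (min (min a b) c)
  have e1 : a - c = 0 := pow_eq_zero_iff two_ne_zero |>.1 (by linarith)
  have e2 : b - c = 0 := pow_eq_zero_iff two_ne_zero |>.1 (by linarith)
  have e3 : 1 - a - b - c = 0 := pow_eq_zero_iff two_ne_zero |>.1 (by linarith)
  have e4 : min (min a b) c = 0 := pow_eq_zero_iff two_ne_zero |>.1 (by linarith)
  obtain rfl : a = c := by linarith
  obtain rfl : b = a := by linarith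
  simp only [min_self] at e4
  subst e4
  norm_num at e3

theorem continuous_triDen : Continuous fun y : ℝ × ℝ × ℝ => triDen y.1 y.2.1 y.2.2 := by
  unfold triDen
  fun_prop

/-- The inverse stereographic projection of `(a - c, b - c) / min a b c`, extended to the
weightings for which `min a b c` vanishes: on the simplex of barycentric coordinates it
collapses the boundary to the base point. -/
noncomputable def triColl (a b c : ℝ) : EuclideanSpace ℝ (Fin 3) :=
  !₂[1 - 2 * min (min a b) c ^ 2 / triDen a b c,
    2 * min (min a b) c * (a - c) / triDen a b c, 2 * min (min a b) c * (b - c) / triDen a b c]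

theorem continuous_triColl : Continuous fun y : ℝ × ℝ × ℝ => triColl y.1 y.2.1 y.2.2 := by
  have h := continuous_triDen
  have h0 : ∀ y : ℝ × ℝ × ℝ, triDen y.1 y.2.1 y.2.2 ≠ 0 := fun y => (triDen_pos _ _ _).ne'
  unfold triColl
  refine (PiLp.continuous_toLp 2 _).comp (continuous_pi fun i => ?_)
  fin_cases i
  · exact continuous_const.sub (Continuous.div (by fun_prop) h h0)
  · exact Continuous.div (by fun_prop) h h0
  · exact Continuous.div (by fun_prop) h h0

theorem triColl_mem_sphere {a b c : ℝ} (h : min (min a b) c * (1 - a - b - c) = 0) :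
    triColl a b c ∈ Metric.sphere (0 : EuclideanSpace ℝ (Fin 3)) 1 := by
  have hD := (triDen_pos a b c).ne'
  rw [mem_sphere_zero_iff_norm, EuclideanSpace.norm_eq, Real.sqrt_eq_one]
  simp only [triColl, Fin.sum_univ_three, Real.norm_eq_abs, sq_abs]
  simp only [Matrix.cons_val]
  field_simp
  have hD' : triDen a b c =
    (a - c) ^ 2 + (b - c) ^ 2 + (1 - a - b - c) ^ 2 + min (min a b) c ^ 2 := rfl
  generalize triDen a b c = D at *
  generalize min (min a b) c = m at *
  linear_combination (-4 * m ^ 2) * hD' - 4 * (m * (1 - a - b - c)) * h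

theorem triColl_of_min_eq_zero {a b c : ℝ} (h : min (min a b) c = 0) :
    triColl a b c = EuclideanSpace.single 0 1 := by
  ext i
  fin_cases i <;> simp [triColl, h]

theorem min_eq_zero_of_triColl {a b c : ℝ} (h : triColl a b c = EuclideanSpace.single 0 1) :
    min (min a b) c = 0 := by
  have := congrFun (congrArg WithLp.ofLp h) 0
  simpa [triColl, (triDen_pos a b c).ne'] using this

theorem triColl_injective {a b c a' b' c' : ℝ} (hm : 0 < min (min a b) c)
    (hm' : 0 < min (min a' b') c') (hs : a + b + c = 1) (hs' : a' + b' + c' = 1)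
    (h : triColl a b c = triColl a' b' c') : a = a' ∧ b = b' ∧ c = c' := by
  have hD := triDen_pos a b c
  have hD' := triDen_pos a' b' c'
  have h0 := congrFun (congrArg WithLp.ofLp h) 0
  have h1 := congrFun (congrArg WithLp.ofLp h) 1
  have h2 := congrFun (congrArg WithLp.ofLp h) 2
  simp only [triColl, Matrix.cons_val] at h0 h1 h2
  set m := min (min a b) c with hmdef
  set m' := min (min a' b') c' with hmdef'
  have h0 : 2 * m ^ 2 / triDen a b c = 2 * m' ^ 2 / triDen a' b' c' := by linarith
  have key : ∀ {x x' : ℝ}, 2 * m * x / triDen a b c = 2 * m' * x' / triDen a' b' c' →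
      x / m = x' / m' := by
    intro x x' hx
    have e : x / m = (2 * m * x / triDen a b c) / (2 * m ^ 2 / triDen a b c) := by
      field_simp
    have e' : x' / m' = (2 * m' * x' / triDen a' b' c') / (2 * m' ^ 2 / triDen a' b' c') := by
      field_simp
    rw [e, e', hx, h0]
  have k1 := key h1
  have k2 := key h2
  have hmin : min (min (a / m) (b / m)) (c / m) = 1 := by
    rw [min_div_div_right hm.le, min_div_div_right hm.le, div_self hm.ne']
  have hmin' : min (min (a' / m') (b' / m')) (c' / m') = 1 := by
    rw [min_div_div_right hm'.le, min_div_div_right hm'.le, div_self hm'.ne']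
  rw [sub_div, sub_div] at k1 k2
  have ec : c / m = c' / m' := by
    clear_value m m'
    generalize a / m = x at *
    generalize b / m = y at *
    generalize c / m = z at *
    generalize a' / m' = x' at *
    generalize b' / m' = y' at *
    generalize c' / m' = z' at *
    clear key h0 h1 h2 hD hD'
    rcases min_cases (min x y) z with h1 | h1 <;> rcases min_cases x y with h2 | h2 <;>
      rcases min_cases (min x' y') z' with h3 | h3 <;> rcases min_cases x' y' with h4 | h4 <;>
      linarith
  have ea : a / m = a' / m' := by linarith
  have eb : b / m = b' / m' := by linarith
  have es : 1 / m = 1 / m' := by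
    calc 1 / m = a / m + b / m + c / m := by rw [← add_div, ← add_div, hs]
      _ = 1 / m' := by rw [ea, eb, ec, ← add_div, ← add_div, hs']
  have em : m = m' := by simpa using es
  rw [em] at ea eb ec
  exact ⟨(div_left_inj' hm'.ne').1 ea, (div_left_inj' hm'.ne').1 eb,
    (div_left_inj' hm'.ne').1 ec⟩

theorem triColl_surjective {z : EuclideanSpace ℝ (Fin 3)}
    (hz : z ∈ Metric.sphere (0 : EuclideanSpace ℝ (Fin 3)) 1) :
    ∃ a b c : ℝ, 0 ≤ a ∧ 0 ≤ b ∧ 0 ≤ c ∧ a + b + c = 1 ∧ triColl a b c = z := by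
  rw [mem_sphere_zero_iff_norm, EuclideanSpace.norm_eq, Real.sqrt_eq_one] at hz
  simp only [Fin.sum_univ_three, Real.norm_eq_abs, sq_abs] at hz
  by_cases h1 : z 0 = 1
  · refine ⟨1, 0, 0, by simp, by simp, by simp, by simp, ?_⟩
    rw [triColl_of_min_eq_zero (by simp)]
    have e1 : z 1 = 0 := pow_eq_zero_iff two_ne_zero |>.1 (by nlinarith [sq_nonneg (z 2)])
    have e2 : z 2 = 0 := pow_eq_zero_iff two_ne_zero |>.1 (by nlinarith [sq_nonneg (z 1)])
    ext i
    fin_cases i <;> simp [h1, e1, e2]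
  · have hlt : 0 < 1 - z 0 := by
      have : z 0 ≤ 1 := by nlinarith [sq_nonneg (z 1), sq_nonneg (z 2)]
      exact sub_pos.2 (this.lt_of_ne h1)
    set u := z 1 / (1 - z 0) with hu
    set v := z 2 / (1 - z 0) with hv
    set k := 1 - min (min u v) 0 with hk
    have hmin : min (min (u + k) (v + k)) k = 1 := by grind
    have ha : 1 ≤ u + k := by grind
    have hb : 1 ≤ v + k := by grind
    have hc : 1 ≤ k := by grind
    set N := (u + k) + (v + k) + k with hN
    have hNp : 0 < N := by linarith
    refine ⟨(u + k) / N, (v + k) / N, k / N, by positivity, by positivity, by positivity, ?_, ?_⟩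
    · rw [← add_div, ← add_div, div_self hNp.ne']
    have hs : (u + k) / N + (v + k) / N + k / N = 1 := by
      rw [← add_div, ← add_div, div_self hNp.ne']
    have hm : min (min ((u + k) / N) ((v + k) / N)) (k / N) = 1 / N := by
      rw [min_div_div_right hNp.le, min_div_div_right hNp.le, hmin]
    have e1 : (u + k) / N - k / N = u / N := by ring
    have e2 : (v + k) / N - k / N = v / N := by ring
    clear_value N
    have hden : triDen ((u + k) / N) ((v + k) / N) (k / N) = (u ^ 2 + v ^ 2 + 1) / N ^ 2 := by
      rw [triDen, hm, e1, e2]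
      have : 1 - (u + k) / N - (v + k) / N - k / N = 0 := by linarith
      rw [this, div_pow, div_pow, div_pow]
      ring
    have huv : u ^ 2 + v ^ 2 + 1 = 2 / (1 - z 0) := by
      rw [hu, hv]
      field_simp
      linear_combination hz
    ext i
    fin_cases i
    · simp only [triColl, hm, hden, huv]
      simp
      field_simp
      ring
    · simp only [triColl, hm, hden, huv, e1]
      simp [hu]
      field_simp
    · simp only [triColl, hm, hden, huv, e2]
      simp [hv]
      field_simp

end SphereCollapse

namespace AbsSC

variable {V : Type}

/-- The smallest of the three weights on the vertices of a triangle. -/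
def depth (t : Fin 3 → V) (x : V → ℝ) : ℝ := min (min (x (t 0)) (x (t 1))) (x (t 2))

theorem continuous_depth (t : Fin 3 → V) : Continuous (depth t) := by
  unfold depth
  fun_prop

theorem depth_nonneg {t : Fin 3 → V} {x : V → ℝ} (h : ∀ v, 0 ≤ x v) : 0 ≤ depth t x :=
  le_min (le_min (h _) (h _)) (h _)

theorem depth_le (t : Fin 3 → V) (x : V → ℝ) (i : Fin 3) : depth t x ≤ x (t i) := by
  unfold depth
  fin_cases i <;> simp

theorem depth_eq_zero {t : Fin 3 → V} {x : V → ℝ} (h : ∀ v, 0 ≤ x v) {i : Fin 3}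
    (hi : x (t i) = 0) : depth t x = 0 :=
  le_antisymm (hi ▸ depth_le t x i) (depth_nonneg h)

theorem depth_pos_iff {t : Fin 3 → V} {x : V → ℝ} : 0 < depth t x ↔ ∀ i, 0 < x (t i) := by
  simp [depth, Fin.forall_fin_succ, and_assoc]

theorem depth_sub_le {t : Fin 3 → V} {x y : V → ℝ} {c : ℝ} (h : ∀ i, y (t i) = x (t i) - c) :
    depth t y = depth t x - c := by
  simp only [depth, h, min_sub_sub_right]

theorem exists_pos_or {K : AbsSC V} {s : ℕ} (τ : Fin s → Fin 3 → V) (x : K.space) :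
    (∀ j, depth (τ j) x.1 = 0) ∨ ∃ j, 0 < depth (τ j) x.1 := by
  by_cases hx : ∃ j, 0 < depth (τ j) x.1
  · exact .inr hx
  · exact .inl fun j => le_antisymm (not_lt.1 fun h' => hx ⟨j, h'⟩) (depth_nonneg x.2.1)

/-- `K` is obtained from `L` by attaching triangles `τ j` along their boundaries. -/
structure TriangleAttachment [DecidableEq V] (K L : AbsSC V) {s : ℕ} (τ : Fin s → Fin 3 → V)
    (E : Finset V) : Prop where
  injective : ∀ j, Function.Injective (τ j)
  mem : ∀ j, univ.image (τ j) ∈ K.faces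
  facet : ∀ j, ∀ σ ∈ K.faces, (∀ i, τ j i ∈ σ) → σ = univ.image (τ j)
  injective_image : ∀ j k, univ.image (τ j) = univ.image (τ k) → j = k
  mem_iff : ∀ σ, σ ∈ L.faces ↔ σ ∈ K.faces ∧ ∀ j, σ ≠ univ.image (τ j)
  subset : ∀ σ ∈ K.faces, σ ⊆ E

namespace TriangleAttachment

variable [DecidableEq V] {K L : AbsSC V} {s : ℕ} {τ : Fin s → Fin 3 → V} {E : Finset V}

theorem ne_zero_iff (h : TriangleAttachment K L τ E) {x : K.space} {j : Fin s}
    (hj : 0 < depth (τ j) x.1) (v : V) : x.1 v ≠ 0 ↔ v ∈ univ.image (τ j) := by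
  obtain ⟨σ, hσ, hs⟩ := space_exists_support x
  rw [← hs, ← h.facet j σ hσ fun i => (hs _).2 (depth_pos_iff.1 hj i).ne']

theorem unique (h : TriangleAttachment K L τ E) {x : K.space} {j k : Fin s}
    (hj : 0 < depth (τ j) x.1) (hk : 0 < depth (τ k) x.1) : j = k :=
  h.injective_image j k <| Finset.ext fun v =>
    (h.ne_zero_iff hj v).symm.trans (h.ne_zero_iff hk v)

theorem depth_eq_zero_of_ne (h : TriangleAttachment K L τ E) {x : K.space} {j k : Fin s}
    (hj : 0 < depth (τ j) x.1) (hk : k ≠ j) : depth (τ k) x.1 = 0 := by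
  by_contra h0
  exact hk (h.unique ((depth_nonneg x.2.1).lt_of_ne' h0) hj)

theorem sum_eq_one (h : TriangleAttachment K L τ E) {x : K.space} {j : Fin s}
    (hj : 0 < depth (τ j) x.1) : x.1 (τ j 0) + x.1 (τ j 1) + x.1 (τ j 2) = 1 := by
  have := space_sum_eq_one x fun v => (h.ne_zero_iff hj v).1
  rwa [sum_image fun a _ b _ => @h.injective j a b, Fin.sum_univ_three] at this

theorem subset_faces (h : TriangleAttachment K L τ E) : L.faces ⊆ K.faces :=
  fun σ hσ => ((h.mem_iff σ).1 hσ).1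

theorem depth_incl (h : TriangleAttachment K L τ E) (x : L.space) (j : Fin s) :
    depth (τ j) x.1 = 0 := by
  obtain ⟨σ, hσ, hs⟩ := space_exists_support x
  by_contra h0
  obtain ⟨hK, hne⟩ := (h.mem_iff σ).1 hσ
  exact hne j <| h.facet j σ hK fun i =>
    (hs _).2 (depth_pos_iff.1 ((depth_nonneg x.2.1).lt_of_ne' h0) i).ne'

theorem exists_face (h : TriangleAttachment K L τ E) {x : K.space}
    (hx : ∀ j, depth (τ j) x.1 = 0) :
    ∃ s ∈ L.faces, (∀ v, x.1 v ≠ 0 → v ∈ s) ∧ ∑ v ∈ s, x.1 v = 1 := by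
  obtain ⟨σ, hσ, hs⟩ := space_exists_support x
  refine ⟨σ, (h.mem_iff σ).2 ⟨hσ, fun j hj => ?_⟩, fun v => (hs v).2,
    space_sum_eq_one x fun v => (hs v).2⟩
  refine (depth_pos_iff.2 fun i => ?_ : 0 < depth (τ j) x.1).ne' (hx j)
  exact (space_nonneg x _).lt_of_ne' ((hs _).1 (by simp [hj]))

/-- Push a weighting away from the barycenters of the attached triangles. -/
def push (τ : Fin s → Fin 3 → V) (κ : ℝ) (x : V → ℝ) (v : V) : ℝ :=
  x v - ∑ j, if v ∈ univ.image (τ j) then min (depth (τ j) x) κ else 0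

theorem push_of_pos (h : TriangleAttachment K L τ E) {x : K.space} {j : Fin s} {κ : ℝ}
    (hκ : 0 ≤ κ) (hj : 0 < depth (τ j) x.1) (v : V) :
    push τ κ x.1 v = x.1 v - if v ∈ univ.image (τ j) then min (depth (τ j) x.1) κ else 0 := by
  unfold push
  rw [sum_eq_single j]
  · intro k _ hk
    rw [h.depth_eq_zero_of_ne hj hk, min_eq_left hκ, ite_self]
  · simp

theorem push_of_depth_eq_zero {x : V → ℝ} {κ : ℝ} (hκ : 0 ≤ κ)
    (hx : ∀ j, depth (τ j) x = 0) (v : V) : push τ κ x v = x v := by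
  simp [push, hx, min_eq_left hκ]

theorem push_nonneg (h : TriangleAttachment K L τ E) (x : K.space) {κ : ℝ} (hκ : 0 ≤ κ) (v : V) :
    0 ≤ push τ κ x.1 v := by
  rcases exists_pos_or τ x with hx | ⟨j, hj⟩
  · rw [push_of_depth_eq_zero hκ hx]
    exact space_nonneg x v
  · rw [h.push_of_pos hκ hj, sub_nonneg]
    split_ifs with hv
    · obtain ⟨i, -, rfl⟩ := mem_image.1 hv
      exact (min_le_left _ _).trans (depth_le _ _ i)
    · exact space_nonneg x v

theorem push_le (x : K.space) {κ : ℝ} (hκ : 0 ≤ κ) (v : V) :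
    push τ κ x.1 v ≤ x.1 v := by
  refine sub_le_self _ (sum_nonneg fun j _ => ?_)
  split_ifs
  · exact le_min (depth_nonneg x.2.1) hκ
  · exact le_rfl

theorem push_exists_ne_zero (h : TriangleAttachment K L τ E) (x : K.space) {κ : ℝ} (hκ : 0 ≤ κ)
    (hκ' : κ ≤ 1 / 6) : ∃ v, push τ κ x.1 v ≠ 0 := by
  rcases exists_pos_or τ x with hx | ⟨j, hj⟩
  · obtain ⟨v, hv⟩ := space_exists_ne_zero x
    exact ⟨v, by rwa [push_of_depth_eq_zero hκ hx]⟩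
  · by_contra! h0
    have h1 : ∀ i, x.1 (τ j i) ≤ κ := fun i => by
      have := h0 (τ j i)
      rw [h.push_of_pos hκ hj, if_pos (mem_image_of_mem _ (mem_univ i))] at this
      exact (sub_eq_zero.1 this).trans_le (min_le_right _ _)
    have := h.sum_eq_one hj
    linarith [h1 0, h1 1, h1 2]

theorem continuous_push (τ : Fin s → Fin 3 → V) :
    Continuous fun z : ℝ × (V → ℝ) => push τ z.1 z.2 := by
  unfold push
  refine continuous_pi fun v => Continuous.sub (by fun_prop) (continuous_finsetSum _ fun j _ => ?_)
  split_ifs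
  · exact ((continuous_depth _).comp continuous_snd).min continuous_fst
  · exact continuous_const

/-- The deformation of the realization given by `push`. -/
noncomputable def pushMap (h : TriangleAttachment K L τ E) :
    C(unitInterval × K.space, K.space) :=
  normalize K E (fun z => push τ (z.1 / 6) z.2.1)
    ((continuous_push τ).comp (((continuous_subtype_val.comp continuous_fst).div_const 6).prodMk
      (continuous_subtype_val.comp continuous_snd)))
    (fun z => h.push_nonneg z.2 (div_nonneg z.1.2.1 (by norm_num)))
    (fun z => h.push_exists_ne_zero z.2 (div_nonneg z.1.2.1 (by norm_num))
      (div_le_div_of_nonneg_right z.1.2.2 (by norm_num)))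
    (fun z => by
      obtain ⟨σ, hσ, hs⟩ := space_exists_support z.2
      refine ⟨σ, hσ, h.subset σ hσ, fun v hv => (hs v).2 fun h0 => hv ?_⟩
      have hκ : (0 : ℝ) ≤ z.1 / 6 := div_nonneg z.1.2.1 (by norm_num)
      exact le_antisymm ((push_le z.2 hκ v).trans_eq h0) (h.push_nonneg z.2 hκ v))

theorem pushMap_apply (h : TriangleAttachment K L τ E) (z : unitInterval × K.space) (v : V) :
    (h.pushMap z).1 v = push τ (z.1 / 6) z.2.1 v / ∑ e ∈ E, push τ (z.1 / 6) z.2.1 e := rfl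

theorem pushMap_zero (h : TriangleAttachment K L τ E) (x : K.space) : h.pushMap (0, x) = x := by
  have h0 : push τ ((0 : unitInterval) / 6) x.1 = x.1 := by
    funext v
    simp [push, min_eq_right (depth_nonneg x.2.1)]
  refine Subtype.ext (funext fun v => ?_)
  rw [pushMap_apply]
  simp only [h0]
  obtain ⟨σ, hσ, hs⟩ := space_exists_support x
  rw [space_sum_eq_one x fun v hv => h.subset σ hσ ((hs v).2 hv), div_one]

theorem depth_pushMap (h : TriangleAttachment K L τ E) {z : unitInterval × K.space}
    (hz : 6 * ∑ j, depth (τ j) z.2.1 ≤ z.1) (k : Fin s) : depth (τ k) (h.pushMap z).1 = 0 := by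
  have hκ : (0 : ℝ) ≤ z.1 / 6 := div_nonneg z.1.2.1 (by norm_num)
  suffices ∃ i, push τ (z.1 / 6) z.2.1 (τ k i) = 0 by
    obtain ⟨i, hi⟩ := this
    exact depth_eq_zero (h.pushMap z).2.1 (i := i) (by rw [pushMap_apply, hi, zero_div])
  rcases exists_pos_or τ z.2 with hx | ⟨j, hj⟩
  · by_contra! h0
    refine (depth_pos_iff.2 fun i => (space_nonneg z.2 _).lt_of_ne' fun h1 => h0 i ?_).ne' (hx k)
    exact (push_of_depth_eq_zero hκ hx _).trans h1
  · by_contra! h0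
    have hpos : ∀ i, 0 < push τ (z.1 / 6) z.2.1 (τ k i) := fun i =>
      (h.push_nonneg z.2 hκ _).lt_of_ne' (h0 i)
    have hk : 0 < depth (τ k) z.2.1 :=
      depth_pos_iff.2 fun i => (hpos i).trans_le (push_le z.2 hκ _)
    have hle : depth (τ k) z.2.1 ≤ z.1 / 6 := by
      have : depth (τ k) z.2.1 ≤ ∑ j, depth (τ j) z.2.1 :=
        single_le_sum (fun j _ => depth_nonneg z.2.2.1) (mem_univ k)
      linarith
    have hd : depth (τ k) (push τ (z.1 / 6) z.2.1) = depth (τ k) z.2.1 - depth (τ k) z.2.1 :=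
      depth_sub_le fun i => by
        rw [h.push_of_pos hκ hk, if_pos (mem_image_of_mem _ (mem_univ i)), min_eq_left hle]
    exact (depth_pos_iff.2 hpos).ne' (hd.trans (sub_self _))

end TriangleAttachment

end AbsSC

namespace AbsSC.TriangleAttachment

variable {V : Type} [DecidableEq V] {K L : AbsSC V} {s : ℕ} {τ : Fin s → Fin 3 → V} {E : Finset V}

/-- A null-homotopy of `L`, run after pushing the attached triangles off their barycenters,
extends to a homotopy of `K`. -/
theorem exists_homotopy (h : TriangleAttachment K L τ E) {x₀ : L.space}
    (hL : (ContinuousMap.id L.space).Homotopic (ContinuousMap.const _ x₀)) :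
    ∃ H : C(unitInterval × K.space, K.space), (∀ x, H (0, x) = x) ∧
      (∀ t x, (∀ j, depth (τ j) x.1 = 0) → ∀ j, depth (τ j) (H (t, x)).1 = 0) ∧
      ∀ x, (∀ j, depth (τ j) x.1 = 0) → H (1, x) = incl h.subset_faces x₀ := by
  obtain ⟨F⟩ := hL
  have hS : Continuous fun z : unitInterval × K.space => ∑ j, depth (τ j) z.2.1 :=
    continuous_finsetSum _ fun _ _ =>
      (continuous_depth _).comp (continuous_subtype_val.comp continuous_snd)
  have ht : Continuous fun z : unitInterval × K.space => (z.1 : ℝ) :=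
    continuous_subtype_val.comp continuous_fst
  let S : unitInterval × K.space → ℝ := fun z => ∑ j, depth (τ j) z.2.1
  let A : Set (unitInterval × K.space) := {z | 6 * S z ≤ z.1}
  let B : Set (unitInterval × K.space) := {z | z.1 ≤ 6 * S z}
  have hA : IsClosed A := isClosed_le (hS.const_mul 6) ht
  have hB : IsClosed B := isClosed_le ht (hS.const_mul 6)
  let G : A → L.space := fun z => ⟨(h.pushMap z.1).1, (h.pushMap z.1).2.1,
    h.exists_face (h.depth_pushMap z.2)⟩
  have hG : Continuous G :=
    Continuous.subtype_mk (continuous_subtype_val.comp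
      (h.pushMap.continuous.comp continuous_subtype_val)) _
  let Q : A → K.space := fun z => incl h.subset_faces
    (F (Set.projIcc 0 1 zero_le_one ((z.1.1 : ℝ) - 6 * S z.1), G z))
  have hQ : Continuous Q := (incl h.subset_faces).continuous.comp
    (F.continuous.comp ((continuous_projIcc.comp
      ((ht.sub (hS.const_mul 6)).comp continuous_subtype_val)).prodMk hG))
  classical
  let H : unitInterval × K.space → K.space := fun z => if hz : z ∈ A then Q ⟨z, hz⟩ else h.pushMap z
  have hHA : ∀ z (hz : z ∈ A), H z = Q ⟨z, hz⟩ := fun z hz => dif_pos hz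
  have hQ0 : ∀ z (hz : z ∈ A), (z.1 : ℝ) = 6 * S z → Q ⟨z, hz⟩ = h.pushMap z := fun z hz he => by
    have : Set.projIcc (0 : ℝ) 1 zero_le_one ((z.1 : ℝ) - 6 * S z) = 0 := by
      rw [he, sub_self]
      exact Set.projIcc_left zero_le_one
    simp only [Q]
    rw [this, F.apply_zero]
    rfl
  have hHB : ∀ z ∈ B, H z = h.pushMap z := fun z hz => by
    by_cases hz' : z ∈ A
    · rw [hHA z hz', hQ0 z hz' (le_antisymm hz hz')]
    · exact dif_neg hz'
  have hH : Continuous H := by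
    rw [← continuousOn_univ, ← (Set.eq_univ_of_forall fun z => le_total (6 * S z) z.1 : A ∪ B = Set.univ)]
    refine ContinuousOn.union_of_isClosed ?_ ?_ hA hB
    · rw [continuousOn_iff_continuous_domRestrict]
      exact hQ.congr fun z => (hHA z.1 z.2).symm
    · exact h.pushMap.continuous.continuousOn.congr hHB
  have hS0 : ∀ t (x : K.space), (∀ j, depth (τ j) x.1 = 0) → S (t, x) = 0 := fun t x hx =>
    sum_eq_zero fun j _ => hx j
  have hmemA : ∀ t (x : K.space), (∀ j, depth (τ j) x.1 = 0) → (t, x) ∈ A := fun t x hx => by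
    simpa [A, hS0 t x hx] using t.2.1
  refine ⟨⟨H, hH⟩, fun x => ?_, fun t x hx j => ?_, fun x hx => ?_⟩
  · refine (hHB _ ?_).trans (h.pushMap_zero x)
    have : 0 ≤ S (0, x) := sum_nonneg fun j _ => depth_nonneg x.2.1
    simpa [B] using this
  · rw [ContinuousMap.coe_mk, hHA _ (hmemA t x hx)]
    exact h.depth_incl _ j
  · rw [ContinuousMap.coe_mk, hHA _ (hmemA 1 x hx)]
    have : Set.projIcc (0 : ℝ) 1 zero_le_one (((1 : unitInterval) : ℝ) - 6 * S (1, x)) = 1 := by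
      rw [hS0 1 x hx, mul_zero, sub_zero]
      exact Set.projIcc_right zero_le_one
    simp only [Q]
    rw [this, F.apply_one]
    rfl

theorem min_mul_eq_zero (h : TriangleAttachment K L τ E) (x : K.space) (j : Fin s) :
    min (min (x.1 (τ j 0)) (x.1 (τ j 1))) (x.1 (τ j 2)) *
      (1 - x.1 (τ j 0) - x.1 (τ j 1) - x.1 (τ j 2)) = 0 := by
  rcases (depth_nonneg x.2.1 : 0 ≤ depth (τ j) x.1).eq_or_lt with h0 | h0
  · exact mul_eq_zero_of_left h0.symm _
  · exact mul_eq_zero_of_right _ (by linarith [h.sum_eq_one h0])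

/-- The map to the sphere collapsing everything outside one attached triangle. -/
noncomputable def toSphere (h : TriangleAttachment K L τ E) (j : Fin s) : C(K.space, Sph 2) where
  toFun x := ⟨triColl (x.1 (τ j 0)) (x.1 (τ j 1)) (x.1 (τ j 2)),
    triColl_mem_sphere (h.min_mul_eq_zero x j)⟩
  continuous_toFun := Continuous.subtype_mk (continuous_triColl.comp
    ((space_continuous_apply _).prodMk
      ((space_continuous_apply _).prodMk (space_continuous_apply _)))) _

theorem toSphere_eq_base (h : TriangleAttachment K L τ E) {x : K.space} {j : Fin s}
    (hj : depth (τ j) x.1 = 0) : h.toSphere j x = sphBase 2 :=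
  Subtype.ext (triColl_of_min_eq_zero hj)

theorem toSphere_ne_base (h : TriangleAttachment K L τ E) {x : K.space} {j : Fin s}
    (hj : 0 < depth (τ j) x.1) : h.toSphere j x ≠ sphBase 2 := fun he =>
  hj.ne' (min_eq_zero_of_triColl (congrArg Subtype.val he))

theorem toSphere_injective (h : TriangleAttachment K L τ E) {x y : K.space} {j : Fin s}
    (hx : 0 < depth (τ j) x.1) (hy : 0 < depth (τ j) y.1)
    (he : h.toSphere j x = h.toSphere j y) : x = y := by
  obtain ⟨h0, h1, h2⟩ := triColl_injective hx hy (h.sum_eq_one hx) (h.sum_eq_one hy)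
    (congrArg Subtype.val he)
  refine Subtype.ext (funext fun v => ?_)
  by_cases hv : v ∈ univ.image (τ j)
  · obtain ⟨i, -, rfl⟩ := mem_image.1 hv
    fin_cases i
    exacts [h0, h1, h2]
  · exact (not_not.1 (mt (h.ne_zero_iff hx v).1 hv)).trans
      (not_not.1 (mt (h.ne_zero_iff hy v).1 hv)).symm

open Classical in
/-- The map collapsing `L` to the base point of the wedge of spheres. -/
noncomputable def collapse (h : TriangleAttachment K L τ E) (x : K.space) : WedgeSph 2 s :=
  if hx : ∃ j, 0 < depth (τ j) x.1 then Quot.mk _ (.inr (hx.choose, h.toSphere hx.choose x))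
  else wedgeSphPt 2 s

theorem collapse_of_depth_eq_zero (h : TriangleAttachment K L τ E) {x : K.space}
    (hx : ∀ j, depth (τ j) x.1 = 0) : h.collapse x = wedgeSphPt 2 s :=
  dif_neg fun ⟨j, hj⟩ => hj.ne' (hx j)

theorem collapse_of_ne (h : TriangleAttachment K L τ E) {x : K.space} {j : Fin s}
    (hx : ∀ k, k ≠ j → depth (τ k) x.1 = 0) :
    h.collapse x = Quot.mk _ (.inr (j, h.toSphere j x)) := by
  by_cases he : ∃ j, 0 < depth (τ j) x.1
  · have hj : he.choose = j := by_contra fun h' => he.choose_spec.ne' (hx _ h')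
    refine (dif_pos he).trans ?_
    rw [hj]
  · have h0 : ∀ j, depth (τ j) x.1 = 0 := fun j =>
      le_antisymm (not_lt.1 fun h' => he ⟨j, h'⟩) (depth_nonneg x.2.1)
    rw [collapse_of_depth_eq_zero h h0, toSphere_eq_base h (h0 j)]
    exact Quot.sound (.glue j)

theorem continuous_collapse (h : TriangleAttachment K L τ E) : Continuous h.collapse := by
  have hd : ∀ k, Continuous fun x : K.space => depth (τ k) x.1 := fun k =>
    (continuous_depth _).comp continuous_subtype_val
  let C : Option (Fin s) → Set K.space := fun o => {x | ∀ k, some k ≠ o → depth (τ k) x.1 = 0}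
  refine (locallyFinite_of_finite C).continuous ?_ (fun o => ?_) (fun o => ?_)
  · refine Set.eq_univ_of_forall fun x => Set.mem_iUnion.2 ?_
    rcases exists_pos_or τ x with hx | ⟨j, hj⟩
    · exact ⟨none, fun k _ => hx k⟩
    · exact ⟨some j, fun k hk => h.depth_eq_zero_of_ne hj fun e => hk (e ▸ rfl)⟩
  · simp only [C, Set.ofPred_forall]
    exact isClosed_iInter fun k => isClosed_iInter fun _ => isClosed_eq (hd k) continuous_const
  · cases o with
    | none => exact continuousOn_const.congr fun x hx =>
        h.collapse_of_depth_eq_zero fun j => hx j (by simp)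
    | some j =>
      have : Continuous fun x => (Quot.mk _ (.inr (j, h.toSphere j x)) : WedgeSph 2 s) :=
        continuous_quot_mk.comp (continuous_inr.comp (continuous_const.prodMk (h.toSphere j).continuous))
      exact this.continuousOn.congr fun x hx =>
        h.collapse_of_ne fun k hk => hx k (by simpa using hk)

/-- Which sphere a point of the wedge belongs to, apart from the base point. -/
noncomputable def wedgeIndex (s : ℕ) : WedgeSph 2 s → Option (Fin s × Sph 2) := by
  classical
  exact Quot.lift (Sum.elim (fun _ => none) fun p => if p.2 = sphBase 2 then none else some p) (by
    rintro _ _ ⟨j⟩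
    simp)

theorem eq_or_of_collapse_eq (h : TriangleAttachment K L τ E) {x y : K.space}
    (he : h.collapse x = h.collapse y) :
    x = y ∨ (∀ j, depth (τ j) x.1 = 0) ∧ ∀ j, depth (τ j) y.1 = 0 := by
  have h0 : ∀ x : K.space, (∀ j, depth (τ j) x.1 = 0) → wedgeIndex s (h.collapse x) = none :=
    fun x hx => by rw [collapse_of_depth_eq_zero h hx]; rfl
  have h1 : ∀ (x : K.space) j, 0 < depth (τ j) x.1 →
      wedgeIndex s (h.collapse x) = some (j, h.toSphere j x) := fun x j hj => by
    rw [h.collapse_of_ne fun k hk => h.depth_eq_zero_of_ne hj hk]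
    exact if_neg (h.toSphere_ne_base hj)
  have he' := congrArg (wedgeIndex s) he
  rcases exists_pos_or τ x with hx | ⟨j, hj⟩ <;> rcases exists_pos_or τ y with hy | ⟨k, hk⟩
  · exact .inr ⟨hx, hy⟩
  · rw [h0 x hx, h1 y k hk] at he'
    simp at he'
  · rw [h0 y hy, h1 x j hj] at he'
    simp at he'
  · rw [h1 x j hj, h1 y k hk] at he'
    obtain ⟨rfl, he'⟩ := Prod.mk.inj (Option.some.inj he')
    exact .inl (h.toSphere_injective hj hk he')

/-- The characteristic map of an attached triangle. -/
noncomputable def cell (h : TriangleAttachment K L τ E) (p : Fin s × stdSimplex ℝ (Fin 3)) :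
    K.space :=
  ⟨fun v => ∑ i, if v = τ p.1 i then p.2.1 i else 0,
    fun v => sum_nonneg fun i _ => by split_ifs; exacts [p.2.2.1 i, le_rfl],
    univ.image (τ p.1), h.mem p.1, fun v hv => by
      obtain ⟨i, -, hi⟩ := exists_ne_zero_of_sum_ne_zero hv
      exact mem_image.2 ⟨i, mem_univ i, by_contra fun h' => hi (if_neg fun e => h' e.symm)⟩, by
      rw [sum_image fun a _ b _ => @h.injective p.1 a b]
      simp only [(h.injective p.1).eq_iff, sum_ite_eq, mem_univ, if_true]
      exact p.2.2.2⟩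

theorem cell_apply (h : TriangleAttachment K L τ E) (p : Fin s × stdSimplex ℝ (Fin 3))
    (i : Fin 3) : (h.cell p).1 (τ p.1 i) = p.2.1 i := by
  change ∑ k, (if τ p.1 i = τ p.1 k then p.2.1 k else 0) = _
  simp only [(h.injective p.1).eq_iff, sum_ite_eq, mem_univ, if_true]

theorem mem_of_cell_ne_zero (h : TriangleAttachment K L τ E) (p : Fin s × stdSimplex ℝ (Fin 3))
    (v : V) (hv : (h.cell p).1 v ≠ 0) : v ∈ univ.image (τ p.1) := by
  have hv' : ∑ i, (if v = τ p.1 i then p.2.1 i else 0) ≠ 0 := hv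
  obtain ⟨i, -, hi⟩ := exists_ne_zero_of_sum_ne_zero hv'
  exact mem_image.2 ⟨i, mem_univ i, by_contra fun h' => hi (if_neg fun e => h' e.symm)⟩

theorem continuous_cell (h : TriangleAttachment K L τ E) : Continuous h.cell := by
  refine Continuous.subtype_mk (continuous_pi fun v => continuous_finsetSum _ fun i _ => ?_) _
  refine continuous_prod_of_discrete_left.2 fun j => ?_
  by_cases hv : v = τ j i
  · simp only [hv, if_true]
    exact (continuous_apply i).comp continuous_subtype_val
  · simp only [hv, if_false]
    exact continuous_const

theorem depth_cell_of_ne (h : TriangleAttachment K L τ E) (p : Fin s × stdSimplex ℝ (Fin 3))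
    {k : Fin s} (hk : k ≠ p.1) : depth (τ k) (h.cell p).1 = 0 := by
  by_contra h0
  have hpos := (depth_nonneg (h.cell p).2.1).lt_of_ne' h0
  refine hk (h.injective_image _ _ (Finset.eq_of_subset_of_card_le (fun v hv => ?_) ?_))
  · exact h.mem_of_cell_ne_zero p v ((h.ne_zero_iff hpos v).2 hv)
  · rw [card_image_of_injective _ (h.injective _), card_image_of_injective _ (h.injective _)]

open Topology in
theorem isQuotientMap_collapse (h : TriangleAttachment K L τ E) (x₀ : L.space) :
    IsQuotientMap h.collapse := by
  let q : Unit ⊕ Fin s × stdSimplex ℝ (Fin 3) → Unit ⊕ Fin s × Sph 2 :=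
    Sum.map id fun p => (p.1, h.toSphere p.1 (h.cell p))
  let ι : Unit ⊕ Fin s × stdSimplex ℝ (Fin 3) → K.space :=
    Sum.elim (fun _ => incl h.subset_faces x₀) h.cell
  have hι : Continuous ι := continuous_const.sumElim h.continuous_cell
  have hq : Continuous q := by
    refine continuous_id.sumMap (continuous_prod_of_discrete_left.2 fun j => ?_)
    exact continuous_const.prodMk ((h.toSphere j).continuous.comp
      (h.continuous_cell.comp (continuous_const.prodMk continuous_id)))
  have hqs : Function.Surjective q := by
    refine Function.Surjective.sumMap Function.surjective_id ?_
    rintro ⟨j, z, hz⟩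
    obtain ⟨a, b, c, ha, hb, hc, hs, he⟩ := triColl_surjective hz
    refine ⟨(j, ⟨![a, b, c], fun i => ?_, ?_⟩), Prod.ext rfl (Subtype.ext ?_)⟩
    · fin_cases i
      exacts [ha, hb, hc]
    · simpa [Fin.sum_univ_three] using hs
    · simp only [toSphere, ContinuousMap.coe_mk]
      rw [cell_apply, cell_apply, cell_apply]
      exact he
  have hqq : IsQuotientMap q := hq.isClosedMap.isQuotientMap hq hqs
  have hmk : IsQuotientMap (Quot.mk (wedgeRel s (Sph 2) (sphBase 2))) := isQuotientMap_quot_mk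
  have he : h.collapse ∘ ι = Quot.mk (wedgeRel s (Sph 2) (sphBase 2)) ∘ q := by
    funext z
    rcases z with z | p
    · exact h.collapse_of_depth_eq_zero (h.depth_incl x₀)
    · exact h.collapse_of_ne fun k hk => h.depth_cell_of_ne p hk
  exact IsQuotientMap.of_comp hι h.continuous_collapse (he ▸ hmk.comp hqq)

/-- Attaching `s` triangles to a contractible complex gives a wedge of `s` spheres. -/
theorem hEquivTop (h : TriangleAttachment K L τ E) {x₀ : L.space}
    (hL : (ContinuousMap.id L.space).Homotopic (ContinuousMap.const _ x₀)) :
    HEquivTop K (WedgeSph 2 s) := by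
  obtain ⟨H, H0, HC, H1⟩ := h.exists_homotopy hL
  refine homotopyEquiv_of_isQuotientMap (h.isQuotientMap_collapse x₀)
    (C := {x | ∀ j, depth (τ j) x.1 = 0}) (fun x y => h.eq_or_of_collapse_eq)
    (fun x hx y hy => ?_) H H0 HC (fun x hx y hy => ?_)
  · rw [h.collapse_of_depth_eq_zero hx, h.collapse_of_depth_eq_zero hy]
  · rw [H1 x hx, H1 y hy]

end AbsSC.TriangleAttachment

section EdgeComplex

variable {α : Type} [DecidableEq α]

theorem exists_eq_pair_of_mem {e : Finset α} (he : e.card = 2) {v : α} (hv : v ∈ e) :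
    ∃ w, v ≠ w ∧ e = {v, w} := by
  obtain ⟨a, b, hab, rfl⟩ := card_eq_two.1 he
  rcases mem_insert.1 hv with rfl | h
  · exact ⟨b, hab, rfl⟩
  · obtain rfl := mem_singleton.1 h
    exact ⟨a, hab.symm, pair_comm _ _⟩

theorem eq_pair_of_mem {e : Finset α} (he : e.card = 2) {v w : α} (hvw : v ≠ w) (hv : v ∈ e)
    (hw : w ∈ e) : e = {v, w} :=
  (eq_of_subset_of_card_le (insert_subset hv (singleton_subset_iff.2 hw))
    (by rw [he, card_pair hvw])).symm

theorem pair_mem_powersetCard {T : Finset α} {a b : α} (hab : a ≠ b) (ha : a ∈ T) (hb : b ∈ T) :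
    {a, b} ∈ T.powersetCard 2 :=
  mem_powersetCard.2 ⟨insert_subset ha (singleton_subset_iff.2 hb), card_pair hab⟩

/-- The complex whose simplices are the sets of pairwise intersecting members of `E`. -/
def edgeCx (E : Finset (Finset α)) : AbsSC (Finset α) where
  faces := {σ | σ.Nonempty ∧ σ ⊆ E ∧ ∀ e ∈ σ, ∀ f ∈ σ, ¬Disjoint e f}
  not_empty_mem h := by simpa using h.1
  down_closed := by
    rintro s ⟨-, hE, hd⟩ t hts hne
    exact ⟨nonempty_iff_ne_empty.2 hne, hts.trans hE, fun e he f hf => hd e (hts he) f (hts hf)⟩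

/-- A family of pairwise intersecting edges containing a triangle is that triangle. -/
theorem eq_powersetCard_of_subset {σ : Finset (Finset α)} {T : Finset α} (hT : T.card = 3)
    (hσ : ∀ e ∈ σ, e.card = 2) (hd : ∀ e ∈ σ, ∀ f ∈ σ, ¬Disjoint e f)
    (h : T.powersetCard 2 ⊆ σ) : σ = T.powersetCard 2 := by
  refine Subset.antisymm (fun e he => mem_powersetCard.2 ⟨?_, hσ e he⟩) h
  have h1 : 1 < (e ∩ T).card := by
    by_contra! h1
    have h2 : 1 < (T \ e).card := by
      have := card_sdiff_add_card_inter T e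
      rw [inter_comm] at this
      omega
    obtain ⟨a, ha, b, hb, hab⟩ := one_lt_card.1 h2
    rw [mem_sdiff] at ha hb
    refine hd e he _ (h (pair_mem_powersetCard hab ha.1 hb.1)) (disjoint_right.2 fun x hx => ?_)
    rcases mem_insert.1 hx with rfl | hx
    · exact ha.2
    · exact mem_singleton.1 hx ▸ hb.2
  have : e ∩ T = e := eq_of_subset_of_card_le inter_subset_left (by rw [hσ e he]; exact h1)
  exact inter_eq_left.1 this

/-- The subcomplex of `edgeCx E` obtained by removing the triangles avoiding `r`. -/
def edgeCxAway (E : Finset (Finset α)) (hE : ∀ e ∈ E, e.card = 2) (r : α) :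
    AbsSC (Finset α) where
  faces := {σ | σ ∈ (edgeCx E).faces ∧ ∀ T : Finset α, T.card = 3 → r ∉ T → σ ≠ T.powersetCard 2}
  not_empty_mem h := (edgeCx E).not_empty_mem h.1
  down_closed := by
    rintro s ⟨hs, hT⟩ t hts hne
    refine ⟨(edgeCx E).down_closed s hs t hts hne, fun T h3 hr he => hT T h3 hr ?_⟩
    exact eq_powersetCard_of_subset h3 (fun e he => hE e (hs.2.1 he)) hs.2.2 (he ▸ hts)

variable {E : Finset (Finset α)} {hE : ∀ e ∈ E, e.card = 2} {r : α}

theorem mem_edgeCxAway_of_forall_mem {σ : Finset (Finset α)} (hne : σ.Nonempty) (hσ : σ ⊆ E)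
    {v : α} (hv : ∀ e ∈ σ, v ∈ e) : σ ∈ (edgeCxAway E hE r).faces := by
  refine ⟨⟨hne, hσ, fun e he f hf => not_disjoint_iff.2 ⟨v, hv e he, hv f hf⟩⟩, ?_⟩
  rintro T h3 - rfl
  have h2 : 1 < (T.erase v).card := by
    have := pred_card_le_card_erase (s := T) (a := v)
    omega
  obtain ⟨a, ha, b, hb, hab⟩ := one_lt_card.1 h2
  have := hv _ (pair_mem_powersetCard hab (mem_of_mem_erase ha) (mem_of_mem_erase hb))
  rcases mem_insert.1 this with rfl | h
  · exact ne_of_mem_erase ha rfl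
  · exact ne_of_mem_erase hb (mem_singleton.1 h).symm

theorem cone_mem_edgeCxAway {e : Finset α} (hcone : ∀ v ∈ e, {r, v} ∈ E) (he : e ∈ E)
    (hr : r ∉ e) : insert e (e.image fun v => {r, v}) ∈ (edgeCxAway E hE r).faces := by
  have hmem : ∀ f ∈ insert e (e.image fun v => {r, v}), f = e ∨ ∃ v ∈ e, f = {r, v} := by
    intro f hf
    rcases mem_insert.1 hf with rfl | hf
    · exact .inl rfl
    · obtain ⟨v, hv, rfl⟩ := mem_image.1 hf
      exact .inr ⟨v, hv, rfl⟩
  obtain ⟨a, ha⟩ : e.Nonempty := card_pos.1 (by rw [hE e he]; norm_num)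
  refine ⟨⟨insert_nonempty _ _, fun f hf => ?_, fun f hf g hg => ?_⟩, ?_⟩
  · rcases hmem f hf with rfl | ⟨v, hv, rfl⟩
    exacts [he, hcone v hv]
  · rw [not_disjoint_iff]
    rcases hmem f hf with rfl | ⟨v, hv, rfl⟩ <;> rcases hmem g hg with rfl | ⟨w, hw, rfl⟩
    exacts [⟨a, ha, ha⟩, ⟨w, hw, by simp⟩, ⟨v, by simp, hv⟩, ⟨r, by simp, by simp⟩]
  · intro T _ hrT heq
    have : ({r, a} : Finset α) ∈ T.powersetCard 2 :=
      heq ▸ mem_insert_of_mem (mem_image_of_mem _ ha)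
    exact hrT ((mem_powersetCard.1 this).1 (mem_insert_self _ _))

/-- If at most one edge of a family avoids `r`, the family lies in the star of `r` or in the
cone over that edge. -/
theorem forall_mem_or_subset_cone {σ : Finset (Finset α)} (hσ : σ ∈ (edgeCx E).faces)
    (hE : ∀ e ∈ E, e.card = 2) (h : ∀ e ∈ σ, ∀ f ∈ σ, r ∉ e → r ∉ f → e = f) :
    (∀ e ∈ σ, r ∈ e) ∨ ∃ e ∈ σ, r ∉ e ∧ σ ⊆ insert e (e.image fun v => {r, v}) := by
  by_cases hr : ∀ e ∈ σ, r ∈ e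
  · exact .inl hr
  · push Not at hr
    obtain ⟨e, he, hre⟩ := hr
    refine .inr ⟨e, he, hre, fun f hf => ?_⟩
    by_cases hrf : r ∈ f
    · obtain ⟨v, hvf, hve⟩ := not_disjoint_iff.1 (hσ.2.2 f hf e he)
      refine mem_insert_of_mem (mem_image.2 ⟨v, hve, ?_⟩)
      exact (eq_pair_of_mem (hE f (hσ.2.1 hf)) (by rintro rfl; exact hre hve) hrf hvf).symm
    · exact mem_insert.2 (.inl (h f hf e he hrf hre))

theorem exists_common_or_subset_cone {σ : Finset (Finset α)}
    (hσ : σ ∈ (edgeCxAway E hE r).faces) :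
    (∃ v, ∀ e ∈ σ, v ∈ e) ∨ ∃ e ∈ σ, r ∉ e ∧ σ ⊆ insert e (e.image fun v => {r, v}) := by
  by_cases h : ∀ e ∈ σ, ∀ f ∈ σ, r ∉ e → r ∉ f → e = f
  · exact (forall_mem_or_subset_cone hσ.1 hE h).imp_left fun h => ⟨r, h⟩
  · push Not at h
    obtain ⟨e, he, f, hf, hre, hrf, hef⟩ := h
    obtain ⟨v, hve, hvf⟩ := not_disjoint_iff.1 (hσ.1.2.2 e he f hf)
    have h2 : ∀ e ∈ σ, e.card = 2 := fun e he => hE e (hσ.1.2.1 he)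
    obtain ⟨a, hva, rfl⟩ := exists_eq_pair_of_mem (h2 e he) hve
    obtain ⟨b, hvb, rfl⟩ := exists_eq_pair_of_mem (h2 f hf) hvf
    have hab : a ≠ b := fun h => hef (h ▸ rfl)
    refine .inl ⟨v, fun g hg => by_contra fun hvg => ?_⟩
    have hag : a ∈ g := by
      obtain ⟨x, hx, hxg⟩ := not_disjoint_iff.1 (hσ.1.2.2 _ he g hg)
      rcases mem_insert.1 hx with rfl | hx
      exacts [absurd hxg hvg, mem_singleton.1 hx ▸ hxg]
    have hbg : b ∈ g := by
      obtain ⟨x, hx, hxg⟩ := not_disjoint_iff.1 (hσ.1.2.2 _ hf g hg)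
      rcases mem_insert.1 hx with rfl | hx
      exacts [absurd hxg hvg, mem_singleton.1 hx ▸ hxg]
    obtain rfl := eq_pair_of_mem (h2 g hg) hab hag hbg
    have h3 : ({v, a, b} : Finset α).card = 3 := card_eq_three.2 ⟨v, a, b, hva, hvb, hab, rfl⟩
    refine hσ.2 {v, a, b} h3 ?_ (eq_powersetCard_of_subset h3 h2 hσ.1.2.2 fun f hf => ?_)
    · simp only [mem_insert, mem_singleton, not_or] at hre hrf ⊢
      exact ⟨hre.1, hre.2, hrf.2⟩
    · obtain ⟨hs, hc⟩ := mem_powersetCard.1 hf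
      obtain ⟨x, y, hxy, rfl⟩ := card_eq_two.1 hc
      have hx := hs (mem_insert_self _ _)
      have hy := hs (mem_insert_of_mem (mem_singleton_self _))
      simp only [mem_insert, mem_singleton] at hx hy
      rcases hx with rfl | rfl | rfl <;> rcases hy with rfl | rfl | rfl <;>
        first | exact absurd rfl hxy | assumption | (rw [pair_comm]; assumption)

end EdgeComplex

section Contraction

variable {α : Type} [DecidableEq α]

/-- Slide weight from the edges avoiding `r` so that at most one of them remains. -/
def thin (E : Finset (Finset α)) (r : α) (x : Finset α → ℝ) (e : Finset α) : ℝ :=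
  if e ∈ E then
    if r ∈ e then
      x e + ∑ p ∈ (E.filter (r ∉ ·)).offDiag,
        if e.erase r ⊆ p.1 ∧ e.erase r ⊆ p.2 then x p.1 * x p.2 else 0
    else max 0 (2 * x e - ∑ f ∈ E.filter (r ∉ ·), x f)
  else 0

/-- Replace an edge avoiding `r` by the edges joining its endpoints to `r`. -/
def reroute (E : Finset (Finset α)) (r : α) (x : Finset α → ℝ) (e : Finset α) : ℝ :=
  if e ∈ E ∧ r ∈ e then x e + ∑ f ∈ E.filter (r ∉ ·), if e.erase r ⊆ f then x f else 0 else 0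

theorem continuous_thin (E : Finset (Finset α)) (r : α) : Continuous (thin E r) := by
  unfold thin
  refine continuous_pi fun e => ?_
  split_ifs
  · refine (continuous_apply e).add (continuous_finsetSum _ fun p _ => ?_)
    split_ifs
    · fun_prop
    · exact continuous_const
  · fun_prop
  · exact continuous_const

theorem continuous_reroute (E : Finset (Finset α)) (r : α) : Continuous (reroute E r) := by
  unfold reroute
  refine continuous_pi fun e => ?_
  split_ifs
  · refine (continuous_apply e).add (continuous_finsetSum _ fun p _ => ?_)
    split_ifs
    · fun_prop
    · exact continuous_const
  · exact continuous_const

variable {E : Finset (Finset α)} {r : α} {x : Finset α → ℝ}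

theorem thin_nonneg (hx : ∀ e, 0 ≤ x e) (e : Finset α) : 0 ≤ thin E r x e := by
  unfold thin
  split_ifs
  · refine add_nonneg (hx e) (sum_nonneg fun p _ => ?_)
    split_ifs
    exacts [mul_nonneg (hx _) (hx _), le_rfl]
  · exact le_max_left _ _
  · exact le_rfl

theorem reroute_nonneg (hx : ∀ e, 0 ≤ x e) (e : Finset α) : 0 ≤ reroute E r x e := by
  unfold reroute
  split_ifs
  · refine add_nonneg (hx e) (sum_nonneg fun p _ => ?_)
    split_ifs
    exacts [hx _, le_rfl]
  · exact le_rfl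

theorem thin_ne_zero {e : Finset α} (hx : ∀ e, 0 ≤ x e) (h : thin E r x e ≠ 0) :
    e ∈ E ∧ (x e ≠ 0 ∨ r ∈ e ∧ ∃ f ∈ E, ∃ g ∈ E, r ∉ f ∧ r ∉ g ∧ f ≠ g ∧ x f ≠ 0 ∧ x g ≠ 0 ∧
      e.erase r ⊆ f ∧ e.erase r ⊆ g) := by
  unfold thin at h
  split_ifs at h with he hr
  · refine ⟨he, ?_⟩
    by_cases h0 : x e = 0
    · rw [h0, zero_add] at h
      obtain ⟨p, hp, hp0⟩ := exists_ne_zero_of_sum_ne_zero h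
      obtain ⟨h1, h2, h3⟩ := mem_offDiag.1 hp
      rw [mem_filter] at h1 h2
      split_ifs at hp0 with hc
      · obtain ⟨h4, h5⟩ := mul_ne_zero_iff.1 hp0
        exact .inr ⟨hr, p.1, h1.1, p.2, h2.1, h1.2, h2.2, h3, h4, h5, hc⟩
      · exact absurd rfl hp0
    · exact .inl h0
  · refine ⟨he, .inl fun h0 => h (max_eq_left ?_)⟩
    rw [h0, mul_zero, zero_sub, neg_nonpos]
    exact sum_nonneg fun f _ => hx f
  · exact absurd rfl h

theorem thin_unique {e f : Finset α} (hx : ∀ e, 0 ≤ x e) (he : thin E r x e ≠ 0)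
    (hf : thin E r x f ≠ 0) (hre : r ∉ e) (hrf : r ∉ f) : e = f := by
  have key : ∀ e, thin E r x e ≠ 0 → r ∉ e → e ∈ E.filter (r ∉ ·) ∧
      ∑ f ∈ E.filter (r ∉ ·), x f < 2 * x e := fun e he hre => by
    have heE := (thin_ne_zero hx he).1
    refine ⟨mem_filter.2 ⟨heE, hre⟩, ?_⟩
    rw [thin, if_pos heE, if_neg hre] at he
    by_contra! h
    exact he (max_eq_left (sub_nonpos.2 h))
  obtain ⟨he1, he2⟩ := key e he hre
  obtain ⟨hf1, hf2⟩ := key f hf hrf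
  by_contra hne
  have := sum_le_sum_of_subset_of_nonneg (f := x) (insert_subset he1 (singleton_subset_iff.2 hf1))
    fun i _ _ => hx i
  rw [sum_pair hne] at this
  linarith

theorem reroute_ne_zero {e : Finset α} (h : reroute E r x e ≠ 0) :
    e ∈ E ∧ r ∈ e ∧ (x e ≠ 0 ∨ ∃ f ∈ E, r ∉ f ∧ x f ≠ 0 ∧ e.erase r ⊆ f) := by
  unfold reroute at h
  split_ifs at h with he
  · refine ⟨he.1, he.2, ?_⟩
    by_cases h0 : x e = 0
    · rw [h0, zero_add] at h
      obtain ⟨f, hf, hf0⟩ := exists_ne_zero_of_sum_ne_zero h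
      rw [mem_filter] at hf
      split_ifs at hf0 with hc
      · exact .inr ⟨f, hf.1, hf.2, hf0, hc⟩
      · exact absurd rfl hf0
    · exact .inl h0
  · exact absurd rfl h

theorem exists_reroute_ne_zero (hE : ∀ e ∈ E, e.card = 2)
    (hcone : ∀ e ∈ E, ∀ v ∈ e, v ≠ r → {r, v} ∈ E) (hx : ∀ e, 0 ≤ x e) {e : Finset α}
    (he : e ∈ E) (h : x e ≠ 0) : ∃ f, reroute E r x f ≠ 0 := by
  have hnn : ∀ e : Finset α, 0 ≤ ∑ f ∈ E.filter (r ∉ ·), if e.erase r ⊆ f then x f else 0 := fun e =>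
    sum_nonneg fun f _ => by split_ifs; exacts [hx f, le_rfl]
  by_cases hr : r ∈ e
  · refine ⟨e, ?_⟩
    rw [reroute, if_pos ⟨he, hr⟩]
    exact (add_pos_of_pos_of_nonneg ((hx e).lt_of_ne' h) (hnn e)).ne'
  · obtain ⟨v, hv⟩ : e.Nonempty := card_pos.1 (by rw [hE e he]; norm_num)
    refine ⟨{r, v}, ?_⟩
    rw [reroute, if_pos ⟨hcone e he v hv (by rintro rfl; exact hr hv), mem_insert_self _ _⟩]
    refine (add_pos_of_nonneg_of_pos (hx _) (sum_pos' (fun f _ => ?_)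
      ⟨e, mem_filter.2 ⟨he, hr⟩, ?_⟩)).ne'
    · split_ifs
      exacts [hx f, le_rfl]
    · rw [if_pos]
      · exact (hx e).lt_of_ne' h
      · intro w hw
        obtain ⟨h1, h2⟩ := mem_erase.1 hw
        rcases mem_insert.1 h2 with rfl | h2
        exacts [absurd rfl h1, mem_singleton.1 h2 ▸ hv]

theorem exists_thin_ne_zero
    (hcone : ∀ e ∈ E, ∀ v ∈ e, v ≠ r → {r, v} ∈ E) (hx : ∀ e, 0 ≤ x e) {e : Finset α}
    (he : e ∈ E) (h : x e ≠ 0) (hd : ∀ e f, x e ≠ 0 → x f ≠ 0 → ¬Disjoint e f) :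
    ∃ f, thin E r x f ≠ 0 := by
  by_contra! h0
  have hprod : ∀ e : Finset α, 0 ≤ ∑ p ∈ (E.filter (r ∉ ·)).offDiag,
      if e.erase r ⊆ p.1 ∧ e.erase r ⊆ p.2 then x p.1 * x p.2 else 0 := fun e =>
    sum_nonneg fun p _ => by split_ifs; exacts [mul_nonneg (hx _) (hx _), le_rfl]
  have hre : r ∉ e := fun hr => by
    refine (add_pos_of_pos_of_nonneg ((hx e).lt_of_ne' h) (hprod e)).ne' ?_
    simpa [thin, he, hr] using h0 e
  have hlt : x e < ∑ f ∈ E.filter (r ∉ ·), x f := by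
    have := h0 e
    rw [thin, if_pos he, if_neg hre] at this
    have := max_eq_left_iff.1 this
    linarith [(hx e).lt_of_ne' h]
  obtain ⟨f, hf, hfe, hf0⟩ : ∃ f ∈ E.filter (r ∉ ·), f ≠ e ∧ x f ≠ 0 := by
    by_contra! hall
    rw [sum_eq_single_of_mem e (mem_filter.2 ⟨he, hre⟩) fun f hf hfe => hall f hf hfe] at hlt
    exact lt_irrefl _ hlt
  obtain ⟨v, hve, hvf⟩ := not_disjoint_iff.1 (hd e f h hf0)
  have hvr : v ≠ r := by rintro rfl; exact hre hve
  have hsub : ∀ g : Finset α, v ∈ g → ({r, v} : Finset α).erase r ⊆ g := fun g hg w hw => by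
    obtain ⟨h1, h2⟩ := mem_erase.1 hw
    rcases mem_insert.1 h2 with rfl | h2
    exacts [absurd rfl h1, mem_singleton.1 h2 ▸ hg]
  have := h0 {r, v}
  rw [thin, if_pos (hcone e he v hve hvr), if_pos (mem_insert_self _ _)] at this
  refine (add_pos_of_nonneg_of_pos (hx _) (sum_pos' (fun p _ => ?_) ⟨(e, f),
    mem_offDiag.2 ⟨mem_filter.2 ⟨he, hre⟩, hf, hfe.symm⟩, ?_⟩)).ne' this
  · split_ifs
    exacts [mul_nonneg (hx _) (hx _), le_rfl]
  · rw [if_pos ⟨hsub e hve, hsub f hvf⟩]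
    exact mul_pos ((hx e).lt_of_ne' h) ((hx f).lt_of_ne' hf0)

end Contraction

namespace AbsSC

variable {α : Type} [DecidableEq α] {E : Finset (Finset α)} {hE : ∀ e ∈ E, e.card = 2} {r : α}

/-- The face carrying both a point and its image under `thin`. -/
theorem exists_face_thin (hcone : ∀ e ∈ E, ∀ v ∈ e, v ≠ r → {r, v} ∈ E)
    (x : (edgeCxAway E hE r).space) : ∃ σ ∈ (edgeCxAway E hE r).faces, σ ⊆ E ∧
      (∀ e, x.1 e ≠ 0 → e ∈ σ) ∧ ∀ e, thin E r x.1 e ≠ 0 → e ∈ σ := by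
  obtain ⟨σ, hσ, hs⟩ := space_exists_support x
  have hmemE : ∀ e ∈ σ, e ∈ E := fun e he => hσ.1.2.1 he
  rcases exists_common_or_subset_cone hσ with ⟨v, hv⟩ | ⟨e, he, hre, hsub⟩
  · refine ⟨E.filter (v ∈ ·), mem_edgeCxAway_of_forall_mem (v := v) ?_ (filter_subset _ _) ?_,
      filter_subset _ _, fun e he => ?_, fun e he => ?_⟩
    · obtain ⟨e, he⟩ := hσ.1.1
      exact ⟨e, mem_filter.2 ⟨hmemE e he, hv e he⟩⟩
    · exact fun e he => (mem_filter.1 he).2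
    · have := (hs e).2 he
      exact mem_filter.2 ⟨hmemE e this, hv e this⟩
    · obtain ⟨heE, h | ⟨hr, f, hf, g, hg, hrf, hrg, hfg, hxf, hxg, hef, heg⟩⟩ :=
        thin_ne_zero x.2.1 he
      · exact mem_filter.2 ⟨heE, hv e ((hs e).2 h)⟩
      · obtain ⟨w, hrw, rfl⟩ := exists_eq_pair_of_mem (hE e heE) hr
        have hw : w ∈ ({r, w} : Finset α).erase r := mem_erase.2 ⟨hrw.symm, by simp⟩
        refine mem_filter.2 ⟨heE, by_contra fun hve => hfg ?_⟩
        have hvw : v ≠ w := by rintro rfl; exact hve (by simp)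
        rw [eq_pair_of_mem (hE f hf) hvw (hv f ((hs f).2 hxf)) (hef hw),
          eq_pair_of_mem (hE g hg) hvw (hv g ((hs g).2 hxg)) (heg hw)]
  · have hun : ∀ f ∈ σ, r ∉ f → f = e := fun f hf hrf => by
      rcases mem_insert.1 (hsub hf) with rfl | hf'
      · rfl
      · obtain ⟨v, -, rfl⟩ := mem_image.1 hf'
        exact absurd (mem_insert_self _ _) hrf
    have hc := cone_mem_edgeCxAway (hE := hE)
      (fun v hv => hcone e (hmemE e he) v hv (by rintro rfl; exact hre hv)) (hmemE e he) hre
    refine ⟨_, hc, hc.1.2.1, fun f hf => hsub ((hs f).2 hf), fun f hf => ?_⟩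
    obtain ⟨-, h | ⟨-, f, -, g, -, hrf, hrg, hfg, hxf, hxg, -⟩⟩ := thin_ne_zero x.2.1 hf
    · exact hsub ((hs _).2 h)
    · exact absurd ((hun f ((hs f).2 hxf) hrf).trans (hun g ((hs g).2 hxg) hrg).symm) hfg

/-- The map of the realization given by `thin`. -/
noncomputable def thinMap (hcone : ∀ e ∈ E, ∀ v ∈ e, v ≠ r → {r, v} ∈ E) :
    C((edgeCxAway E hE r).space, (edgeCxAway E hE r).space) :=
  normalize _ E (fun x => thin E r x.1) ((continuous_thin E r).comp continuous_subtype_val)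
    (fun x => thin_nonneg x.2.1)
    (fun x => by
      obtain ⟨σ, hσ, hs⟩ := space_exists_support x
      obtain ⟨e, he⟩ := space_exists_ne_zero x
      exact exists_thin_ne_zero hcone x.2.1 (hσ.1.2.1 ((hs e).2 he)) he
        fun e f he hf => hσ.1.2.2 e ((hs e).2 he) f ((hs f).2 hf))
    (fun x => by
      obtain ⟨σ, hσ, h1, -, h2⟩ := exists_face_thin hcone x
      exact ⟨σ, hσ, h1, h2⟩)

/-- The map of the realization given by `reroute`. -/
noncomputable def rerouteMap (hcone : ∀ e ∈ E, ∀ v ∈ e, v ≠ r → {r, v} ∈ E) :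
    C((edgeCxAway E hE r).space, (edgeCxAway E hE r).space) :=
  have hex : ∀ x : (edgeCxAway E hE r).space, ∃ e, reroute E r x.1 e ≠ 0 := fun x => by
    obtain ⟨σ, hσ, hs⟩ := space_exists_support x
    obtain ⟨e, he⟩ := space_exists_ne_zero x
    exact exists_reroute_ne_zero hE hcone x.2.1 (hσ.1.2.1 ((hs e).2 he)) he
  normalize _ E (fun x => reroute E r x.1) ((continuous_reroute E r).comp continuous_subtype_val)
    (fun x => reroute_nonneg x.2.1) hex
    (fun x => by
      obtain ⟨e, he⟩ := hex x
      have hmem : ∀ e, reroute E r x.1 e ≠ 0 → e ∈ E.filter (r ∈ ·) := fun e he =>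
        mem_filter.2 ⟨(reroute_ne_zero he).1, (reroute_ne_zero he).2.1⟩
      exact ⟨_, mem_edgeCxAway_of_forall_mem ⟨e, hmem e he⟩ (filter_subset _ _)
        fun e he => (mem_filter.1 he).2, filter_subset _ _, hmem⟩)

theorem thinMap_ne_zero {hcone : ∀ e ∈ E, ∀ v ∈ e, v ≠ r → {r, v} ∈ E}
    {x : (edgeCxAway E hE r).space} {e : Finset α} (he : (thinMap hcone x).1 e ≠ 0) :
    thin E r x.1 e ≠ 0 :=
  (div_ne_zero_iff.1 he).1

theorem rerouteMap_ne_zero {hcone : ∀ e ∈ E, ∀ v ∈ e, v ≠ r → {r, v} ∈ E}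
    {x : (edgeCxAway E hE r).space} {e : Finset α} (he : (rerouteMap hcone x).1 e ≠ 0) :
    reroute E r x.1 e ≠ 0 :=
  (div_ne_zero_iff.1 he).1

theorem exists_face_reroute (hcone : ∀ e ∈ E, ∀ v ∈ e, v ≠ r → {r, v} ∈ E)
    (x : (edgeCxAway E hE r).space) (hx : ∀ e f, x.1 e ≠ 0 → x.1 f ≠ 0 → r ∉ e → r ∉ f → e = f) :
    ∃ σ ∈ (edgeCxAway E hE r).faces,
      (∀ e, x.1 e ≠ 0 → e ∈ σ) ∧ ∀ e, reroute E r x.1 e ≠ 0 → e ∈ σ := by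
  obtain ⟨σ, hσ, hs⟩ := space_exists_support x
  have hmemE : ∀ e ∈ σ, e ∈ E := fun e he => hσ.1.2.1 he
  rcases forall_mem_or_subset_cone hσ.1 hE fun e he f hf => hx e f ((hs e).1 he) ((hs f).1 hf)
    with hr | ⟨e, he, hre, hsub⟩
  · obtain ⟨e, he⟩ := hσ.1.1
    refine ⟨E.filter (r ∈ ·), mem_edgeCxAway_of_forall_mem (v := r)
      ⟨e, mem_filter.2 ⟨hmemE e he, hr e he⟩⟩ (filter_subset _ _)
      (fun e he => (mem_filter.1 he).2), fun e he => ?_, fun e he => ?_⟩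
    · have := (hs e).2 he
      exact mem_filter.2 ⟨hmemE e this, hr e this⟩
    · exact mem_filter.2 ⟨(reroute_ne_zero he).1, (reroute_ne_zero he).2.1⟩
  · refine ⟨_, cone_mem_edgeCxAway (hE := hE)
      (fun v hv => hcone e (hmemE e he) v hv (by rintro rfl; exact hre hv)) (hmemE e he) hre,
      fun f hf => hsub ((hs f).2 hf), fun f hf => ?_⟩
    obtain ⟨hfE, hrf, h | ⟨g, -, hrg, hxg, hfg⟩⟩ := reroute_ne_zero hf
    · exact hsub ((hs f).2 h)
    · obtain rfl := hx e g ((hs e).1 he) hxg hre hrg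
      obtain ⟨w, hrw, rfl⟩ := exists_eq_pair_of_mem (hE f hfE) hrf
      exact mem_insert_of_mem (mem_image_of_mem _ (hfg (mem_erase.2 ⟨hrw.symm, by simp⟩)))

/-- Removing the triangles avoiding a cone vertex `r` leaves a contractible complex. -/
theorem edgeCxAway_nullhomotopic (hcone : ∀ e ∈ E, ∀ v ∈ e, v ≠ r → {r, v} ∈ E)
    (hne : ∃ e ∈ E, r ∈ e) : ∃ x₀, (ContinuousMap.id (edgeCxAway E hE r).space).Homotopic
      (ContinuousMap.const _ x₀) := by
  obtain ⟨e₀, he₀, hr₀⟩ := hne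
  let x₀ : (edgeCxAway E hE r).space := ⟨Pi.single e₀ 1, fun e => by
    by_cases h : e = e₀
    · subst h; simp
    · simp [h], {e₀}, mem_edgeCxAway_of_forall_mem (v := r) ⟨e₀, mem_singleton_self _⟩
      (singleton_subset_iff.2 he₀) (fun e he => mem_singleton.1 he ▸ hr₀), fun e he => by
      by_contra h
      exact he (Pi.single_eq_of_ne (mt mem_singleton.2 h) _), by simp⟩
  refine ⟨x₀, ContinuousMap.Homotopic.trans (g := thinMap hcone) ?_
    (ContinuousMap.Homotopic.trans (g := (rerouteMap hcone).comp (thinMap hcone)) ?_ ?_)⟩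
  · refine homotopic_of_common_face _ _ fun x => ?_
    obtain ⟨σ, hσ, -, h1, h2⟩ := exists_face_thin hcone x
    exact ⟨σ, hσ, h1, fun e he => h2 e (thinMap_ne_zero he)⟩
  · refine homotopic_of_common_face _ _ fun x => ?_
    obtain ⟨σ, hσ, h1, h2⟩ := exists_face_reroute hcone (thinMap hcone x) fun e f he hf =>
      thin_unique x.2.1 (thinMap_ne_zero he) (thinMap_ne_zero hf)
    exact ⟨σ, hσ, h1, fun e he => h2 e (rerouteMap_ne_zero (hcone := hcone) he)⟩
  · refine homotopic_of_common_face _ _ fun x => ⟨E.filter (r ∈ ·),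
      mem_edgeCxAway_of_forall_mem (v := r) ⟨e₀, mem_filter.2 ⟨he₀, hr₀⟩⟩ (filter_subset _ _)
      fun e he => (mem_filter.1 he).2, fun e he => ?_, fun e he => ?_⟩
    · obtain ⟨h1, h2, -⟩ := reroute_ne_zero (rerouteMap_ne_zero (hcone := hcone) he)
      exact mem_filter.2 ⟨h1, h2⟩
    · have : e = e₀ := by
        by_contra h
        exact he (Pi.single_eq_of_ne h _)
      exact this ▸ mem_filter.2 ⟨he₀, hr₀⟩

end AbsSC

section Triangles

variable {α : Type} [DecidableEq α]

theorem subset_of_powersetCard_subset {S T : Finset α} (hT : 1 < T.card)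
    (h : T.powersetCard 2 ⊆ S.powersetCard 2) : T ⊆ S := by
  intro a ha
  obtain ⟨b, hb, hba⟩ := exists_mem_ne hT a
  exact (mem_powersetCard.1 (h (pair_mem_powersetCard hba.symm ha hb))).1 (mem_insert_self _ _)

/-- The triangles all of whose edges belong to `E` and which avoid `r`. -/
def trianglesAway (E : Finset (Finset α)) (r : α) : Finset (Finset α) :=
  ((E.biUnion id).powersetCard 3).filter fun T => r ∉ T ∧ T.powersetCard 2 ⊆ E

theorem mem_trianglesAway {E : Finset (Finset α)} {r : α} {T : Finset α} :
    T ∈ trianglesAway E r ↔ T.card = 3 ∧ r ∉ T ∧ T.powersetCard 2 ⊆ E := by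
  simp only [trianglesAway, mem_filter, mem_powersetCard]
  refine ⟨fun h => ⟨h.1.2, h.2⟩, fun h => ⟨⟨fun a ha => ?_, h.1⟩, h.2⟩⟩
  obtain ⟨b, hb, hba⟩ := exists_mem_ne (by rw [h.1]; norm_num : 1 < T.card) a
  exact mem_biUnion.2 ⟨_, h.2.2 (pair_mem_powersetCard hba.symm ha hb), mem_insert_self _ _⟩

theorem powersetCard_mem_edgeCx {E : Finset (Finset α)} {T : Finset α} (hT : T.card = 3)
    (h : T.powersetCard 2 ⊆ E) : T.powersetCard 2 ∈ (edgeCx E).faces := by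
  refine ⟨card_pos.1 (by rw [card_powersetCard, hT]; decide), h, fun e he f hf hd => ?_⟩
  rw [mem_powersetCard] at he hf
  have := card_le_card (union_subset he.1 hf.1)
  rw [card_union_of_disjoint hd] at this
  omega

/-- A pairwise-intersection complex of edges with a cone vertex `r` is a wedge of 2-spheres, one
for every triangle avoiding `r`. -/
theorem edgeCx_hEquivTop {E : Finset (Finset α)} {r : α} (hE : ∀ e ∈ E, e.card = 2)
    (hcone : ∀ e ∈ E, ∀ v ∈ e, v ≠ r → {r, v} ∈ E) (hne : ∃ e ∈ E, r ∈ e) {s : ℕ}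
    (hs : (trianglesAway E r).card = s) : (edgeCx E).HEquivTop (WedgeSph 2 s) := by
  obtain ⟨x₀, hx₀⟩ := AbsSC.edgeCxAway_nullhomotopic (hE := hE) hcone hne
  let T : Fin s → Finset α := fun j => ((equivFinOfCardEq hs).symm j).1
  have hT : ∀ j, (T j).card = 3 ∧ r ∉ T j ∧ (T j).powersetCard 2 ⊆ E := fun j =>
    mem_trianglesAway.1 ((equivFinOfCardEq hs).symm j).2
  have h3 : ∀ j, ((T j).powersetCard 2).card = 3 := fun j => by
    rw [card_powersetCard, (hT j).1]; decide
  let τ : Fin s → Fin 3 → Finset α := fun j i => ((equivFinOfCardEq (h3 j)).symm i).1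
  have hτ : ∀ j, univ.image (τ j) = (T j).powersetCard 2 := fun j => by
    ext e
    simp only [mem_image, mem_univ, true_and]
    refine ⟨fun ⟨i, hi⟩ => hi ▸ Subtype.property _, fun he =>
      ⟨equivFinOfCardEq (h3 j) ⟨e, he⟩, ?_⟩⟩
    simp [τ]
  have hK : ∀ σ ∈ (edgeCx E).faces, ∀ e ∈ σ, e.card = 2 := fun σ hσ e he => hE e (hσ.2.1 he)
  refine AbsSC.TriangleAttachment.hEquivTop (τ := τ) (E := E) ?_ hx₀
  refine ⟨fun j => Subtype.val_injective.comp (Equiv.injective _), fun j => ?_,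
    fun j σ hσ h => ?_, fun j k h => ?_, fun σ => ⟨fun h => ⟨h.1, fun j => ?_⟩, fun h => ⟨h.1, ?_⟩⟩,
    fun σ hσ => hσ.2.1⟩
  · rw [hτ]
    exact powersetCard_mem_edgeCx (hT j).1 (hT j).2.2
  · rw [hτ]
    refine eq_powersetCard_of_subset (hT j).1 (hK σ hσ) hσ.2.2 ?_
    rw [← hτ]
    exact image_subset_iff.2 fun i _ => h i
  · rw [hτ, hτ] at h
    have := eq_of_subset_of_card_le (subset_of_powersetCard_subset (by rw [(hT j).1]; norm_num)
      h.subset) (by rw [(hT j).1, (hT k).1])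
    exact (equivFinOfCardEq hs).symm.injective (Subtype.ext this)
  · rw [hτ]
    exact h.2 _ (hT j).1 (hT j).2.1
  · rintro U hU hr rfl
    have hmem : U ∈ trianglesAway E r := mem_trianglesAway.2 ⟨hU, hr, h.1.2.1⟩
    refine h.2 (equivFinOfCardEq hs ⟨U, hmem⟩) ?_
    rw [hτ]
    simp [T]

end Triangles

theorem List.lex_of_sorted {l₁ l₂ : List ℕ} {u : ℕ} (h₁ : l₁.Pairwise (· < ·))
    (h₂ : l₂.Pairwise (· < ·)) (hlen : l₁.length = l₂.length) (hu₁ : u ∈ l₁) (hu₂ : u ∉ l₂)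
    (h : ∀ w < u, w ∈ l₁ ↔ w ∈ l₂) : List.Lex (· < ·) l₁ l₂ := by
  induction l₁ generalizing l₂ with
  | nil => simp at hu₁
  | cons a l ih =>
    cases l₂ with
    | nil => simp at hlen
    | cons b l' =>
      obtain ⟨ha, hl⟩ := List.pairwise_cons.1 h₁
      obtain ⟨hb, hl'⟩ := List.pairwise_cons.1 h₂
      rcases lt_trichotomy a b with hab | rfl | hab
      · exact .rel hab
      · have hua : u ≠ a := by rintro rfl; simp at hu₂
        refine .cons (ih hl hl' (by simpa using hlen) (by simpa [hua] using hu₁)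
          (fun h => hu₂ (List.mem_cons_of_mem _ h)) fun w hw => ?_)
        have := h w hw
        simp only [List.mem_cons] at this
        refine ⟨fun hwl => ?_, fun hwl => ?_⟩
        · exact (this.1 (.inr hwl)).resolve_left (ha w hwl).ne'
        · exact (this.2 (.inr hwl)).resolve_left (hb w hwl).ne'
      · have hau : a ≤ u := by
          rcases List.mem_cons.1 hu₁ with rfl | hu
          exacts [le_rfl, (ha u hu).le]
        rcases List.mem_cons.1 ((h b (hab.trans_le hau)).2 (List.mem_cons_self ..)) with rfl | hb'
        exacts [absurd hab (lt_irrefl _), absurd (ha b hb') hab.not_gt]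

theorem lex_sort {X Y : Finset ℕ} {u : ℕ} (hcard : X.card = Y.card) (hX : u ∈ X) (hY : u ∉ Y)
    (h : ∀ w < u, w ∈ X ↔ w ∈ Y) :
    List.Lex (· < ·) (X.sort (· ≤ ·)) (Y.sort (· ≤ ·)) :=
  List.lex_of_sorted (sortedLT_sort X).pairwise (sortedLT_sort Y).pairwise
    (by simpa using hcard) (by simpa) (by simpa) (by simpa)

theorem lex_asymm {l₁ l₂ : List ℕ} (h : List.Lex (· < ·) l₁ l₂) : ¬List.Lex (· < ·) l₂ l₁ :=
  fun h' => lt_asymm (show l₁ < l₂ from h) h'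

section LinkEdges

theorem card_symmDiff_add {α : Type} [DecidableEq α] (X Y : Finset α) :
    (symmDiff X Y).card + 2 * (X ∩ Y).card = X.card + Y.card := by
  have h1 := card_sdiff_add_card_inter X Y
  have h2 := card_sdiff_add_card_inter Y X
  rw [inter_comm] at h2
  rw [symmDiff_def, sup_eq_union, card_union_of_disjoint disjoint_sdiff_sdiff]
  omega

/-- The two-element subsets of `[m]` whose larger element lies in `A`. -/
def linkEdges (m : ℕ) (A : Finset ℕ) : Finset (Finset ℕ) :=
  ((Icc 1 m).powersetCard 2).filter fun e => ∃ v ∈ A, v ∈ e ∧ ∀ u ∈ e, u ≤ v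

theorem card_of_mem_linkEdges {m : ℕ} {A e : Finset ℕ} (h : e ∈ linkEdges m A) : e.card = 2 :=
  (mem_powersetCard.1 (mem_filter.1 h).1).2

theorem pair_mem_linkEdges {m : ℕ} {A : Finset ℕ} (hA : A ⊆ Icc 1 m) {u v : ℕ} (huv : u < v) :
    {u, v} ∈ linkEdges m A ↔ 1 ≤ u ∧ v ∈ A := by
  rw [linkEdges, mem_filter, mem_powersetCard]
  constructor
  · rintro ⟨⟨hs, -⟩, w, hwA, hw, hmax⟩
    refine ⟨(mem_Icc.1 (hs (mem_insert_self _ _))).1, ?_⟩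
    have := hmax v (by simp)
    rcases mem_insert.1 hw with rfl | hw
    · omega
    · exact mem_singleton.1 hw ▸ hwA
  · rintro ⟨hu, hv⟩
    have hv' := hA hv
    refine ⟨⟨insert_subset ?_ (singleton_subset_iff.2 hv'), card_pair huv.ne⟩, v, hv, by simp,
      by simp [huv.le]⟩
    rw [mem_Icc] at hv' ⊢
    omega

theorem exists_lt_of_card_eq_two {e : Finset ℕ} (h : e.card = 2) : ∃ u v, u < v ∧ e = {u, v} := by
  obtain ⟨a, b, hab, rfl⟩ := card_eq_two.1 h
  rcases hab.lt_or_gt with h | h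
  exacts [⟨a, b, h, rfl⟩, ⟨b, a, h, pair_comm _ _⟩]

/-- The neighbours of `A` correspond to the members of `linkEdges m A` via `B ↦ B Δ A`. -/
theorem symmDiff_mem_linkEdges_iff {m n : ℕ} {A B : Finset ℕ} (hA : A ⊆ Icc 1 m)
    (hn : A.card = n) (hn2 : 2 ≤ n) :
    symmDiff B A ∈ linkEdges m A ↔
      B ∈ (Fnm m (n - 2) ∪ Fnm m n) ∩ FprecLE m A ∧ B ≠ A ∧ (symmDiff B A).card ≤ 2 := by
  have hlexl : ∀ u, B.card = A.card → u ∈ symmDiff B A → (∀ w ∈ symmDiff B A, u ≤ w) → u ∈ B →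
      List.Lex (· < ·) (B.sort (· ≤ ·)) (A.sort (· ≤ ·)) := fun u hc hu hmin hB => by
    rw [mem_symmDiff] at hu
    refine lex_sort hc hB (by tauto) fun w hw => ?_
    have := mt (hmin w) hw.not_ge
    rw [mem_symmDiff] at this
    tauto
  have hlexr : ∀ u, B.card = A.card → u ∈ symmDiff B A → (∀ w ∈ symmDiff B A, u ≤ w) → u ∈ A →
      List.Lex (· < ·) (A.sort (· ≤ ·)) (B.sort (· ≤ ·)) := fun u hc hu hmin hB => by
    rw [mem_symmDiff] at hu
    refine lex_sort hc.symm hB (by tauto) fun w hw => ?_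
    have := mt (hmin w) hw.not_ge
    rw [mem_symmDiff] at this
    tauto
  have hcard := card_symmDiff_add (symmDiff B A) A
  rw [symmDiff_symmDiff_cancel_right] at hcard
  have hmin : ∀ {u v : ℕ}, u < v → symmDiff B A = {u, v} → ∀ w ∈ symmDiff B A, u ≤ w := by
    intro u v huv he w hw
    rw [he] at hw
    simp only [mem_insert, mem_singleton] at hw
    omega
  constructor
  · intro h
    have h2 := card_of_mem_linkEdges h
    obtain ⟨u, v, huv, he⟩ := exists_lt_of_card_eq_two h2
    rw [he, pair_mem_linkEdges hA huv] at h
    have hu : u ∈ symmDiff B A := by simp [he]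
    have hv : v ∈ symmDiff B A := by simp [he]
    have hBm : B ⊆ Icc 1 m := fun w hw => by
      by_cases hwA : w ∈ A
      · exact hA hwA
      · have : w ∈ symmDiff B A := mem_symmDiff.2 (.inl ⟨hw, hwA⟩)
        have hvm := hA h.2
        simp only [he, mem_insert, mem_singleton, mem_Icc] at this hvm ⊢
        omega
    refine ⟨?_, by rintro rfl; simp at hu, h2.le⟩
    by_cases huA : u ∈ A
    · have hint : symmDiff B A ∩ A = symmDiff B A := inter_eq_left.2 (by
        rw [he]; exact insert_subset huA (singleton_subset_iff.2 h.2))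
      rw [hint] at hcard
      exact ⟨.inl ⟨hBm, by omega⟩, hBm, .inl (.inl (by omega))⟩
    · have hint : symmDiff B A ∩ A = {v} := by
        rw [he, insert_inter_of_notMem huA, singleton_inter_of_mem h.2]
      rw [hint, card_singleton] at hcard
      have hBc : B.card = A.card := by omega
      have huB : u ∈ B := by
        rw [mem_symmDiff] at hu
        tauto
      exact ⟨.inr ⟨hBm, by omega⟩, hBm,
        .inl (.inr ⟨hBc, hlexl u hBc hu (hmin huv he) huB⟩)⟩
  · rintro ⟨⟨hF, hBm, hle⟩, hne, h2⟩
    have hBc : B.card = n - 2 ∨ B.card = n := hF.imp (·.2) (·.2)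
    have hpos : 0 < (symmDiff B A).card := card_pos.2 (by
      rw [nonempty_iff_ne_empty]
      exact fun h => hne (symmDiff_eq_bot.1 h))
    have h2 : (symmDiff B A).card = 2 := by omega
    obtain ⟨u, v, huv, he⟩ := exists_lt_of_card_eq_two h2
    have hu : u ∈ symmDiff B A := by simp [he]
    have hv : v ∈ symmDiff B A := by simp [he]
    have hlt : precLT B A := hle.resolve_right hne
    rw [he, pair_mem_linkEdges hA huv]
    have hsub : symmDiff B A ⊆ Icc 1 m := fun w hw => by
      rcases mem_symmDiff.1 hw with h | h
      exacts [hBm h.1, hA h.1]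
    refine ⟨(mem_Icc.1 (hsub hu)).1, by_contra fun hvA => ?_⟩
    by_cases huA : u ∈ A
    · have hint : symmDiff B A ∩ A = {u} := by
        rw [he, insert_inter_of_mem huA, singleton_inter_of_notMem hvA]
        rfl
      rw [hint, card_singleton] at hcard
      have hBc : B.card = A.card := by omega
      have hlt' := hlt.resolve_left (by omega)
      exact lex_asymm hlt'.2 (hlexr u hBc hu (hmin huv he) huA)
    · have hint : symmDiff B A ∩ A = ∅ := by
        rw [he, insert_inter_of_notMem huA, singleton_inter_of_notMem hvA]
      rw [hint, card_empty] at hcard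
      omega

theorem self_mem_prec {m n : ℕ} {A : Finset ℕ} (hA : A ⊆ Icc 1 m) (hn : A.card = n) :
    A ∈ (Fnm m (n - 2) ∪ Fnm m n) ∩ FprecLE m A :=
  ⟨.inr ⟨hA, hn⟩, hA, .inr rfl⟩

theorem card_symmDiff_le_two_iff {α : Type} [DecidableEq α] {e f : Finset α} (he : e.card = 2)
    (hf : f.card = 2) : (symmDiff e f).card ≤ 2 ↔ ¬Disjoint e f := by
  have := card_symmDiff_add e f
  rw [disjoint_iff_inter_eq_empty, ← card_eq_zero]
  omega

/-- The link of `A` is the pairwise-intersection complex of `linkEdges m A`. -/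
theorem link_homeomorph {m n : ℕ} {A : Finset ℕ} (hA : A ⊆ Icc 1 m) (hn : A.card = n)
    (hn2 : 2 ≤ n) :
    Nonempty (((VRc ((Fnm m (n - 2) ∪ Fnm m n) ∩ FprecLE m A) 2).link A).space ≃ₜ
      (edgeCx (linkEdges m A)).space) := by
  have key := fun B => symmDiff_mem_linkEdges_iff (B := B) hA hn hn2
  have hd : ∀ B C : Finset ℕ, symmDiff (symmDiff B A) (symmDiff C A) = symmDiff B C := fun B C => by
    rw [symmDiff_comm C A, symmDiff_assoc, symmDiff_symmDiff_cancel_left]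
  let φ : Finset ℕ ≃ Finset ℕ := Function.Involutive.toPerm (fun B => symmDiff B A)
    fun B => symmDiff_symmDiff_cancel_right A B
  have hφ : ∀ (σ : Finset (Finset ℕ)) e, e ∈ σ.map φ.toEmbedding ↔ ∃ B ∈ σ, symmDiff B A = e :=
    fun σ e => mem_map
  refine AbsSC.homeomorph_of_equiv φ fun σ => ⟨?_, ?_⟩
  · rintro ⟨hne, hAσ, -, hF, hdiam⟩
    have hE : ∀ B ∈ σ, symmDiff B A ∈ linkEdges m A := fun B hB => (key B).2
      ⟨hF B (mem_union_left _ hB), fun h => hAσ (h ▸ hB),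
        hdiam B (mem_union_left _ hB) A (mem_union_right _ (mem_singleton_self A))⟩
    refine ⟨(nonempty_iff_ne_empty.2 hne).map, fun e he => ?_, fun e he f hf => ?_⟩
    · obtain ⟨B, hB, rfl⟩ := (hφ σ e).1 he
      exact hE B hB
    · obtain ⟨B, hB, rfl⟩ := (hφ σ e).1 he
      obtain ⟨C, hC, rfl⟩ := (hφ σ f).1 hf
      rw [← card_symmDiff_le_two_iff (card_of_mem_linkEdges (hE B hB))
        (card_of_mem_linkEdges (hE C hC)), hd]
      exact hdiam B (mem_union_left _ hB) C (mem_union_left _ hC)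
  · rintro ⟨hne, hE, hdis⟩
    have hE' : ∀ B ∈ σ, symmDiff B A ∈ linkEdges m A := fun B hB => hE ((hφ σ _).2 ⟨B, hB, rfl⟩)
    refine ⟨nonempty_iff_ne_empty.1 (map_nonempty.1 hne), fun hAσ => ?_,
      ⟨A, mem_union_right _ (mem_singleton_self A)⟩, fun B hB => ?_, fun B hB C hC => ?_⟩
    · exact ((key A).1 (hE' A hAσ)).2.1 rfl
    · rcases mem_union.1 hB with hB | hB
      · exact ((key B).1 (hE' B hB)).1
      · rw [mem_singleton.1 hB]
        exact self_mem_prec hA hn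
    · rcases mem_union.1 hB with hB | hB <;> rcases mem_union.1 hC with hC | hC
      · rw [← hd, card_symmDiff_le_two_iff (card_of_mem_linkEdges (hE' B hB))
          (card_of_mem_linkEdges (hE' C hC))]
        exact hdis _ ((hφ σ _).2 ⟨B, hB, rfl⟩) _ ((hφ σ _).2 ⟨C, hC, rfl⟩)
      · rw [mem_singleton.1 hC]
        exact ((key B).1 (hE' B hB)).2.2
      · rw [mem_singleton.1 hB, symmDiff_comm]
        exact ((key C).1 (hE' C hC)).2.2
      · simp [mem_singleton.1 hB, mem_singleton.1 hC]

end LinkEdges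

section Count

/-- Triangles of `linkEdges m A` away from `r = max A`, grouped by their least element. -/
theorem trianglesAway_linkEdges {m r : ℕ} {A : Finset ℕ} (hA : A ⊆ Icc 1 m)
    (hmax : ∀ a ∈ A, a ≤ r) :
    trianglesAway (linkEdges m A) r =
      (Ico 1 r).biUnion fun p =>
        (((A.erase r).filter (p < ·)).powersetCard 2).image (insert p) := by
  ext T
  simp only [mem_trianglesAway, mem_biUnion, mem_image, mem_powersetCard, mem_Ico]
  constructor
  · rintro ⟨hT, hr, hE⟩
    have hne : T.Nonempty := card_pos.1 (by omega)
    have hlt : ∀ w ∈ T.erase (T.min' hne), T.min' hne < w ∧ 1 ≤ T.min' hne ∧ w ∈ A := fun w hw => by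
      have h := T.min'_lt_of_mem_erase_min' hne hw
      exact ⟨h, (pair_mem_linkEdges hA h).1 <|
        hE (pair_mem_powersetCard h.ne (T.min'_mem hne) (mem_of_mem_erase hw))⟩
    have hc : (T.erase (T.min' hne)).card = 2 := by
      rw [card_erase_of_mem (T.min'_mem hne), hT]
    obtain ⟨w, hw⟩ : (T.erase (T.min' hne)).Nonempty := card_pos.1 (by omega)
    refine ⟨T.min' hne, ⟨(hlt w hw).2.1, (hlt w hw).1.trans_le (hmax w (hlt w hw).2.2)⟩,
      T.erase (T.min' hne), ⟨fun v hv => ?_, hc⟩, insert_erase (T.min'_mem hne)⟩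
    exact mem_filter.2 ⟨mem_erase.2 ⟨fun h => hr (h ▸ mem_of_mem_erase hv), (hlt v hv).2.2⟩,
      (hlt v hv).1⟩
  · rintro ⟨p, ⟨hp1, hpr⟩, S, ⟨hS, hS2⟩, rfl⟩
    have hS' : ∀ w ∈ S, w ≠ r ∧ w ∈ A ∧ p < w := fun w hw => by
      have h := mem_filter.1 (hS hw)
      exact ⟨ne_of_mem_erase h.1, mem_of_mem_erase h.1, h.2⟩
    have hpS : p ∉ S := fun h => (hS' p h).2.2.false
    refine ⟨by rw [card_insert_of_notMem hpS, hS2], fun h => ?_, fun e he => ?_⟩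
    · rcases mem_insert.1 h with h | h
      · exact hpr.ne' h
      · exact (hS' r h).1 rfl
    · obtain ⟨heS, he2⟩ := mem_powersetCard.1 he
      obtain ⟨u, v, huv, rfl⟩ := exists_lt_of_card_eq_two he2
      rw [pair_mem_linkEdges hA huv]
      have hu := mem_insert.1 (heS (mem_insert_self u {v}))
      have hv := mem_insert.1 (heS (mem_insert_of_mem (mem_singleton_self v)))
      have hpu : p ≤ u := by
        rcases hu with rfl | hu
        exacts [le_rfl, (hS' u hu).2.2.le]
      refine ⟨hp1.trans hpu, (hS' v (hv.resolve_left ?_)).2.1⟩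
      omega

theorem card_trianglesAway_linkEdges {m r : ℕ} {A : Finset ℕ} (hA : A ⊆ Icc 1 m)
    (hmax : ∀ a ∈ A, a ≤ r) :
    (trianglesAway (linkEdges m A) r).card =
      ∑ p ∈ Ico 1 r, ((A.erase r).filter (p < ·)).card.choose 2 := by
  have hlt : ∀ p : ℕ, ∀ S ∈ ((A.erase r).filter (p < ·)).powersetCard 2, ∀ w ∈ S, p < w :=
    fun p S hS w hw => (mem_filter.1 ((mem_powersetCard.1 hS).1 hw)).2
  rw [trianglesAway_linkEdges hA hmax, card_biUnion]
  · refine sum_congr rfl fun p _ => ?_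
    rw [card_image_of_injOn, card_powersetCard]
    intro S hS S' hS' h
    have h' : insert p S = insert p S' := h
    rw [← erase_insert (fun hp => (hlt p S hS p hp).false), h',
      erase_insert (fun hp => (hlt p S' hS' p hp).false)]
  · intro p _ p' _ hne
    refine disjoint_left.2 ?_
    intro T hT hT'
    obtain ⟨S, hS, rfl⟩ := mem_image.1 hT
    obtain ⟨S', hS', h⟩ := mem_image.1 hT'
    have h1 : p' ∈ insert p S := h ▸ mem_insert_self _ _
    have h2 : p ∈ insert p' S' := h ▸ mem_insert_self _ _
    have h3 := hlt p S hS p' ((mem_insert.1 h1).resolve_left hne.symm)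
    have h4 := hlt p' S' hS' p ((mem_insert.1 h2).resolve_left hne)
    omega

variable {n : ℕ} {i : Fin n → ℕ}

/-- Between consecutive entries, the number of larger entries other than the last is constant. -/
theorem card_filter_lt_image (hmono : StrictMono i) {p j : ℕ} (hj : j < n)
    (hlo : ∀ k : Fin n, k.1 < j → i k ≤ p) (hhi : p < ith i j) :
    (((image i univ).erase (ith i (n - 1))).filter (p < ·)).card = n - 1 - j := by
  have hlast : ith i (n - 1) = i ⟨n - 1, by omega⟩ := by rw [ith, dif_pos]
  rw [ith, dif_pos hj] at hhi
  have : ((image i univ).erase (ith i (n - 1))).filter (p < ·) =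
      (Ico (⟨j, hj⟩ : Fin n) ⟨n - 1, by omega⟩).image i := by
    ext a
    simp only [mem_filter, mem_erase, mem_image, mem_univ, true_and, mem_Ico]
    constructor
    · rintro ⟨⟨hne, k, rfl⟩, hk⟩
      have hk1 : k.1 ≠ n - 1 := fun h => hne (by rw [hlast]; congr 1; exact Fin.ext h)
      have hk2 : ¬ k.1 < j := fun h => (hlo k h).not_gt hk
      exact ⟨k, ⟨Fin.le_def.2 (by simpa using hk2), Fin.lt_def.2 (by have := k.2; simp; omega)⟩, rfl⟩
    · rintro ⟨k, ⟨hjk, hk⟩, rfl⟩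
      exact ⟨⟨hlast ▸ (hmono hk).ne, k, rfl⟩, hhi.trans_le (hmono.monotone hjk)⟩
  rw [this, card_image_of_injective _ hmono.injective, Fin.card_Ico]

theorem sum_choose_card_filter_lt (hmono : StrictMono i) (h1 : 1 ≤ ith i 0) {j : ℕ} (hj : j < n) :
    ∑ p ∈ Ico 1 (ith i j),
        (((image i univ).erase (ith i (n - 1))).filter (p < ·)).card.choose 2 =
      (∑ k ∈ range j, (n - 2 - k).choose 2) +
        ∑ ℓ ∈ Icc 1 (j + 1),
          (if ℓ = 1 then ith i 0 - 1 else ith i (ℓ - 1) - (ith i (ℓ - 2) + 1)) *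
            (n - ℓ).choose 2 := by
  induction j with
  | zero =>
    rw [sum_congr rfl fun p hp => by
      rw [card_filter_lt_image hmono hj (by simp) (mem_Ico.1 hp).2]]
    simp
  | succ j ih =>
    have hjn : j < n := by omega
    have hj0 : (⟨0, by omega⟩ : Fin n) ≤ ⟨j, hjn⟩ := Fin.le_def.2 (Nat.zero_le _)
    have hlt : ith i j < ith i (j + 1) := by
      rw [ith, dif_pos hjn, ith, dif_pos hj]
      exact hmono (Fin.lt_def.2 (Nat.lt_succ_self _))
    have h1j : 1 ≤ ith i j := by
      rw [ith, dif_pos (by omega)] at h1 ⊢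
      exact h1.trans (hmono.monotone hj0)
    have hlo : ∀ p ∈ Ico (ith i j) (ith i (j + 1)), ∀ k : Fin n, k.1 < j + 1 → i k ≤ p :=
      fun p hp k hk => by
        refine le_trans ?_ (mem_Ico.1 hp).1
        rw [ith, dif_pos hjn]
        exact hmono.monotone (Fin.le_def.2 (Nat.lt_succ_iff.1 hk))
    rw [← sum_Ico_consecutive _ h1j hlt.le, ih hjn,
      sum_congr (rfl : Ico (ith i j) _ = _) fun p hp => by
        rw [card_filter_lt_image hmono hj (hlo p hp) (mem_Ico.1 hp).2],
      sum_const, Nat.card_Ico, sum_range_succ, sum_Icc_succ_top (by omega : 1 ≤ j + 1 + 1),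
      if_neg (by omega), show n - 1 - (j + 1) = n - 2 - j by omega,
      show n - (j + 1 + 1) = n - 2 - j by omega, show j + 1 + 1 - 1 = j + 1 by omega,
      show j + 1 + 1 - 2 = j by omega, smul_eq_mul,
      show ith i (j + 1) - ith i j = ith i (j + 1) - (ith i j + 1) + 1 by omega]
    ring

theorem card_trianglesAway_linkEdges_image (hmono : StrictMono i) {m : ℕ}
    (hA : image i univ ⊆ Icc 1 m) (h1 : 1 ≤ ith i 0) (hn : 2 ≤ n)
    (hmax : ∀ a ∈ image i univ, a ≤ ith i (n - 1)) :
    (trianglesAway (linkEdges m (image i univ)) (ith i (n - 1))).card =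
      (∑ k ∈ Icc 2 (n - 2), k.choose 2) +
        ∑ ℓ ∈ Icc 1 (n - 2),
          (if ℓ = 1 then ith i 0 - 1 else ith i (ℓ - 1) - (ith i (ℓ - 2) + 1)) *
            (n - ℓ).choose 2 := by
  rw [card_trianglesAway_linkEdges hA hmax, sum_choose_card_filter_lt hmono h1 (by omega)]
  congr 1
  · rw [show n - 2 = n - 1 - 1 by omega, sum_range_reflect fun k => k.choose 2]
    refine (sum_subset (fun k hk => ?_) fun k hk hk' => ?_).symm
    · simp only [mem_Icc, mem_range] at hk ⊢
      omega
    · refine Nat.choose_eq_zero_of_lt ?_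
      simp only [mem_Icc, mem_range] at hk hk'
      omega
  · refine (sum_subset (Icc_subset_Icc_right (by omega)) fun ℓ h h' => ?_).symm
    rw [Nat.choose_eq_zero_of_lt, mul_zero]
    simp only [mem_Icc] at h h'
    omega

end Count

/-- For `4 ≤ n < m - 1` and `A = i_1 ⋯ i_n ⊆ [m]` with `i_1 ≥ 2`, letting
`K = VR(F^m_{n-2} ∪ F^m_n, 2) ∩ VR(F^m_{⪯A}, 2)`, the link of `A` in `K` is homotopy
equivalent to a wedge of `s_A = Σ_{k=2}^{n-2} C(k,2) + Σ_{ℓ=1}^{n-2} c_ℓ·C(n-ℓ,2)` copies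
of `S²`, where `c_1 = i_1 - 1` and `c_ℓ = i_ℓ - (i_{ℓ-1} + 1)`. -/
theorem stmt16 (m n : ℕ) (hn : 4 ≤ n) (hm : n + 1 < m)
    (A : Finset ℕ) (hAm : A ⊆ Finset.Icc 1 m)
    (i : Fin n → ℕ) (hmono : StrictMono i) (h2 : 2 ≤ ith i 0)
    (hAi : A = Finset.image i Finset.univ) :
    AbsSC.HEquivTop ((VRc ((Fnm m (n - 2) ∪ Fnm m n) ∩ FprecLE m A) 2).link A)
      (WedgeSph 2 ((∑ k ∈ Finset.Icc 2 (n - 2), Nat.choose k 2) +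
        ∑ ℓ ∈ Finset.Icc 1 (n - 2),
          (if ℓ = 1 then ith i 0 - 1 else ith i (ℓ - 1) - (ith i (ℓ - 2) + 1)) *
            (n - ℓ).choose 2)) := by
  subst hAi
  have hcard : (image i univ).card = n := by
    rw [card_image_of_injective _ hmono.injective, card_fin]
  have hi : ∀ {j} (hj : j < n), ith i j = i ⟨j, hj⟩ := fun hj => dif_pos hj
  have hr : ith i (n - 1) ∈ image i univ := by
    rw [hi (by omega)]
    exact mem_image_of_mem _ (mem_univ _)
  have hmax : ∀ a ∈ image i univ, a ≤ ith i (n - 1) := fun a ha => by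
    obtain ⟨k, -, rfl⟩ := mem_image.1 ha
    rw [hi (by omega)]
    exact hmono.monotone (Fin.le_def.2 (by have := k.2; simp; omega))
  have hpair : ∀ {w}, 1 ≤ w → w < ith i (n - 1) →
      {ith i (n - 1), w} ∈ linkEdges m (image i univ) := fun hw h => by
    rw [pair_comm, pair_mem_linkEdges hAm h]
    exact ⟨hw, hr⟩
  have h0r : ith i 0 < ith i (n - 1) := by
    rw [hi (by omega), hi (by omega)]
    exact hmono (Fin.lt_def.2 (by simp; omega))
  obtain ⟨h⟩ := link_homeomorph hAm hcard (by omega)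
  obtain ⟨g⟩ := edgeCx_hEquivTop (E := linkEdges m (image i univ)) (r := ith i (n - 1))
    (fun e he => card_of_mem_linkEdges he)
    (fun e he w hw hwr => by
      obtain ⟨u, v, huv, rfl⟩ := exists_lt_of_card_eq_two (card_of_mem_linkEdges he)
      have h := (pair_mem_linkEdges hAm huv).1 he
      have hv := hmax v h.2
      simp only [mem_insert, mem_singleton] at hw
      exact hpair (by omega) (by omega))
    ⟨_, hpair (by omega) h0r, mem_insert_self _ _⟩
    (card_trianglesAway_linkEdges_image hmono hAm (by omega) (by omega) hmax)
  exact ⟨h.toHomotopyEquiv.trans g⟩
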